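/- Let k ≥ 2, 3 ≤ r ≤ 2k and n ≥ 100k be integers. If G is an n-vertex C_{2k+1}-free simple graph with e(G) ≥ ⌊(n−r+1)²/4⌋ + C(r,2) (where C(r,2) = r(r−1)/2), then either G belongs to the family 𝒢_{n,r}, or G is obtained from the bipartite Turán graph T_{n−r+1,2} by suspending K_r. -/

import Mathlib

/-- A graph is `m`-cycle-free if it contains no cycle of length `m`. -/
def SimpleGraph.CycleFree {V : Type*} (G : SimpleGraph V) (m : ℕ) : Prop :=
  ∀ ⦃v : V⦄ (w : G.Walk v v), w.IsCycle → w.length ≠ m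

/-- The spectral radius of a finite graph: the largest (real) eigenvalue of its
adjacency matrix, i.e. the supremum of the set of real eigenvalues. -/
noncomputable def SimpleGraph.specRad {V : Type*} [Fintype V] (G : SimpleGraph V) : ℝ :=
  letI : DecidableRel G.Adj := Classical.decRel _
  sSup {μ : ℝ | ∃ x : V → ℝ, x ≠ 0 ∧ (SimpleGraph.adjMatrix ℝ G).mulVec x = μ • x}

/-- A graph is 2-connected if it has at least 3 vertices, is connected, and removing
any single vertex leaves it connected. -/
def SimpleGraph.TwoConnected {V : Type*} (G : SimpleGraph V) : Prop :=
  3 ≤ Nat.card V ∧ G.Connected ∧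
    ∀ v : V, (G.induce (({v} : Set V)ᶜ)).Connected

/-- `turanSuspAt n q v0`: the `n`-vertex graph obtained from the complete bipartite graph
with parts `{0, …, q/2 - 1}` and `{q/2, …, q-1}` (the bipartite Turán graph `T_{q,2}`)
by putting a clique on `{v0} ∪ {q, …, n-1}`; for `v0 < q` this is `T_{q,2}` with a
clique `K_{n-q+1}` suspended at the vertex `v0`. -/
def turanSuspAt (n q v0 : ℕ) : SimpleGraph (Fin n) :=
  SimpleGraph.fromRel (fun i j =>
    ((i : ℕ) < q / 2 ∧ q / 2 ≤ (j : ℕ) ∧ (j : ℕ) < q) ∨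
    (((i : ℕ) = v0 ∨ q ≤ (i : ℕ)) ∧ ((j : ℕ) = v0 ∨ q ≤ (j : ℕ))))

/-- The family `𝒢_{n,r}`: graphs obtained from a bipartite graph by suspending graphs
`G_1, …, G_s` whose parts outside the bipartite graph have at most `r - 2` vertices
in total. -/
def FamilyG (n r : ℕ) (G : SimpleGraph (Fin n)) : Prop :=
  ∃ (s : ℕ) (W : Fin s → Finset (Fin n)) (v : Fin s → Fin n),
    (∀ i j, i ≠ j → Disjoint (W i) (W j)) ∧
    (Finset.univ.biUnion W).card ≤ r - 2 ∧
    (∀ i, v i ∉ Finset.univ.biUnion W) ∧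
    (∃ A : Set (Fin n), ∀ x y, G.Adj x y →
        x ∉ Finset.univ.biUnion W → y ∉ Finset.univ.biUnion W →
        ((x ∈ A ∧ y ∉ A) ∨ (x ∉ A ∧ y ∈ A))) ∧
    (∀ i j, i ≠ j → ∀ x ∈ W i, ∀ y ∈ W j, ¬ G.Adj x y) ∧
    (∀ i, ∀ x ∈ W i, ∀ y, G.Adj x y → y ∉ Finset.univ.biUnion W → y = v i)

/-- The family `𝒢*_{n,r}`: as `FamilyG`, but with exactly `r - 2` vertices outside the
bipartite part. -/
def FamilyGStar (n r : ℕ) (G : SimpleGraph (Fin n)) : Prop :=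
  ∃ (s : ℕ) (W : Fin s → Finset (Fin n)) (v : Fin s → Fin n),
    (∀ i j, i ≠ j → Disjoint (W i) (W j)) ∧
    (Finset.univ.biUnion W).card = r - 2 ∧
    (∀ i, v i ∉ Finset.univ.biUnion W) ∧
    (∃ A : Set (Fin n), ∀ x y, G.Adj x y →
        x ∉ Finset.univ.biUnion W → y ∉ Finset.univ.biUnion W →
        ((x ∈ A ∧ y ∉ A) ∨ (x ∉ A ∧ y ∈ A))) ∧
    (∀ i j, i ≠ j → ∀ x ∈ W i, ∀ y ∈ W j, ¬ G.Adj x y) ∧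
    (∀ i, ∀ x ∈ W i, ∀ y, G.Adj x y → y ∉ Finset.univ.biUnion W → y = v i)

/-- `H` is a `k`-dense bipartite graph: bipartite, 2-connected, any two distinct vertices
in the same part are joined by paths of every odd order `5 ≤ h ≤ 2k+1`, and any two
vertices in different parts are joined by paths of every even order `6 ≤ s ≤ 2k+2`. -/
def KDenseBip {V : Type*} (k : ℕ) (H : SimpleGraph V) : Prop :=
  H.TwoConnected ∧
  ∃ A : Set V,
    (∀ ⦃x y : V⦄, H.Adj x y → ((x ∈ A ∧ y ∉ A) ∨ (x ∉ A ∧ y ∈ A))) ∧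
    (∀ u v : V, u ≠ v → (u ∈ A ↔ v ∈ A) → ∀ h : ℕ, Odd h → 5 ≤ h → h ≤ 2 * k + 1 →
      ∃ p : H.Walk u v, p.IsPath ∧ p.length + 1 = h) ∧
    (∀ u v : V, ¬(u ∈ A ↔ v ∈ A) → ∀ s : ℕ, Even s → 6 ≤ s → s ≤ 2 * k + 2 →
      ∃ p : H.Walk u v, p.IsPath ∧ p.length + 1 = s)

/-- The graph obtained from the complete bipartite graph with parts `{0, …, a}` (size `a+1`)
and `{a+1, …, a+b}` (size `b`) by identifying the vertex `0` with one vertex of a clique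
on `r-1` vertices whose remaining `r-2` vertices `{a+b+1, …, a+b+r-2}` are new. -/
def bipCliqueGraph (a b r : ℕ) : SimpleGraph (Fin (a + b + r - 1)) :=
  SimpleGraph.fromRel (fun i j =>
    ((i : ℕ) ≤ a ∧ a + 1 ≤ (j : ℕ) ∧ (j : ℕ) ≤ a + b) ∨
    (((i : ℕ) = 0 ∨ a + b + 1 ≤ (i : ℕ)) ∧ ((j : ℕ) = 0 ∨ a + b + 1 ≤ (j : ℕ))))

section Ears

variable {V : Type*} {G : SimpleGraph V}

theorem SimpleGraph.CycleFree.false_of_closed_chain {m : ℕ} (hf : G.CycleFree m) (hm : 3 ≤ m)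
    {a : V} {L : List V} (hc : List.IsChain G.Adj (a :: (L ++ [a]))) (hn : (a :: L).Nodup)
    (hl : L.length + 1 = m) : False := by
  have key : ∀ (b : V) (w : G.Walk a b), w.support = a :: (L ++ [a]) → False := by
    intro b w hw
    have hb : b = a := by
      have h1 := w.getLast_support
      simpa [hw, List.getLast_append] using h1.symm
    subst hb
    have hlen : w.length = m := by
      have h1 := w.length_support
      rw [hw] at h1
      simp at h1
      omega
    refine hf w ?_ hlen
    rw [SimpleGraph.Walk.isCycle_iff_isPath_tail_and_le_length]
    refine ⟨?_, by omega⟩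
    rw [SimpleGraph.Walk.isPath_def, SimpleGraph.Walk.support_tail_of_not_nil, hw]
    · simp only [List.tail_cons]
      grind
    · intro h
      have := SimpleGraph.Walk.length_eq_zero_iff.2 h
      omega
  refine key _ (SimpleGraph.Walk.ofSupport (a :: (L ++ [a])) (by simp) hc) ?_
  exact SimpleGraph.Walk.support_ofSupport (by simp) hc

/-- A nodup list `M` outside `D` forming, together with two distinct ends `a, b ∈ D`, a path. -/
structure IsEar (G : SimpleGraph V) (D : Set V) (a : V) (M : List V) (b : V) : Prop where
  left : a ∈ D
  right : b ∈ D
  ne : a ≠ b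
  outside : ∀ x ∈ M, x ∉ D
  nodup : M.Nodup
  chain : List.IsChain G.Adj (a :: (M ++ [b]))

theorem IsEar.reverse {D : Set V} {a b : V} {M : List V} (h : IsEar G D a M b) :
    IsEar G D b M.reverse a where
  left := h.right
  right := h.left
  ne := h.ne.symm
  outside := by simpa using h.outside
  nodup := by simpa using h.nodup
  chain := by
    have h1 := h.chain
    rw [← List.isChain_reverse]
    simp only [List.reverse_cons, List.reverse_append, List.reverse_reverse]
    simpa [G.adj_comm] using h1

/-- The colouring `χ` extends properly along every ear of `D`. -/
def EarConsistent (G : SimpleGraph V) (D : Set V) (χ : V → Bool) : Prop :=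
  ∀ ⦃a M b⦄, IsEar G D a M b → (χ a = χ b ↔ Odd M.length)

theorem EarConsistent.adj_ne {D : Set V} {χ : V → Bool} (h : EarConsistent G D χ) {a b : V}
    (ha : a ∈ D) (hb : b ∈ D) (hab : G.Adj a b) : χ a ≠ χ b := by
  have := h (M := []) ⟨ha, hb, hab.ne, by simp, by simp, by simpa using hab⟩
  simpa using this

end Ears

section Ears

variable {V : Type*} {G : SimpleGraph V}

theorem IsEar.splice {D : Set V} {a b s t : V} {M₁ M₂ M₃ Z : List V}
    (h : IsEar G D a (M₁ ++ s :: (M₂ ++ t :: M₃)) b)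
    (hZ : IsEar G (D ∪ {x | x ∈ M₁ ++ s :: (M₂ ++ t :: M₃)}) s Z t) :
    IsEar G D a (M₁ ++ s :: (Z ++ t :: M₃)) b where
  left := h.left
  right := h.right
  ne := h.ne
  outside := by
    have h1 := h.outside
    have h2 := hZ.outside
    intro x hx
    simp only [List.mem_append, List.mem_cons, Set.mem_union, Set.mem_ofPred_eq] at h1 h2 hx
    grind
  nodup := by
    have h1 := h.nodup
    have h2 := hZ.nodup
    have h3 := hZ.outside
    simp only [List.mem_append, List.mem_cons, Set.mem_union, Set.mem_ofPred_eq] at h3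
    simp only [List.nodup_append, List.nodup_cons, List.mem_append, List.mem_cons] at h1 ⊢
    grind
  chain := by
    have h1 := h.chain
    have h2 := hZ.chain
    simp only [List.append_assoc, List.cons_append] at h1 ⊢
    rw [List.isChain_cons_split] at h1 ⊢
    exact ⟨h1.1, List.isChain_cons_split.2 ⟨h2, (List.isChain_cons_split.1 h1.2).2⟩⟩

theorem IsEar.graft {D : Set V} {a b s t : V} {M₁ M₂ Z : List V}
    (h : IsEar G D a (M₁ ++ s :: M₂) b)
    (hZ : IsEar G (D ∪ {x | x ∈ M₁ ++ s :: M₂}) s Z t) (ht : t ∈ D) (hta : t ≠ a) :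
    IsEar G D a (M₁ ++ s :: Z) t where
  left := h.left
  right := ht
  ne := hta.symm
  outside := by
    have h1 := h.outside
    have h2 := hZ.outside
    intro x hx
    simp only [List.mem_append, List.mem_cons, Set.mem_union, Set.mem_ofPred_eq] at h1 h2 hx
    grind
  nodup := by
    have h1 := h.nodup
    have h2 := hZ.nodup
    have h3 := hZ.outside
    simp only [List.mem_append, List.mem_cons, Set.mem_union, Set.mem_ofPred_eq] at h3
    simp only [List.nodup_append, List.nodup_cons, List.mem_cons] at h1 ⊢
    grind
  chain := by
    have h1 := h.chain
    have h2 := hZ.chain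
    simp only [List.append_assoc, List.cons_append] at h1 ⊢
    rw [List.isChain_cons_split] at h1 ⊢
    exact ⟨h1.1, h2⟩

/-- The mod-two bookkeeping behind extending a colouring along ears. -/
theorem bool_eq_iff_odd {A B S T : Bool} {i j l z : ℕ} (hS : S = A ↔ Odd i) (hT : T = B ↔ Odd j)
    (hAB : A = B ↔ Odd l) (hp : Even (i + j + l + z)) : S = T ↔ Odd z := by
  simp only [Nat.odd_iff, Nat.even_iff] at *
  cases A <;> cases B <;> cases S <;> cases T <;> simp at * <;> omega

theorem EarConsistent.exists_extend {D : Set V} {χ : V → Bool} (h : EarConsistent G D χ)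
    {a b : V} {M : List V} (hM : IsEar G D a M b) :
    ∃ χ' : V → Bool, EarConsistent G (D ∪ {x | x ∈ M}) χ' := by
  classical
  obtain ⟨χ', hχ, hχM⟩ : ∃ χ' : V → Bool, (∀ x, x ∉ M → χ' x = χ x) ∧
      ∀ M₁ x M₂, M = M₁ ++ x :: M₂ → (χ' x = χ a ↔ Odd M₁.length) := by
    refine ⟨fun x => if x ∈ M then (if Odd (M.idxOf x) then χ a else !χ a) else χ x,
      fun x hx => by simp [hx], ?_⟩
    rintro M₁ x M₂ rfl
    have h1 : x ∉ M₁ := by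
      have := hM.nodup
      simp only [List.nodup_append, List.mem_cons] at this
      grind
    simp [List.idxOf_append, h1]
  have hab := h hM
  have hMD := hM.outside
  have hMM : ∀ s Z t M₁ M₂ M₃, M = M₁ ++ s :: (M₂ ++ t :: M₃) →
      IsEar G (D ∪ {x | x ∈ M}) s Z t → (χ' s = χ' t ↔ Odd Z.length) := by
    rintro s Z t M₁ M₂ M₃ rfl hZ
    have h1 := h (hM.splice hZ)
    have h2 := hχM M₁ s _ rfl
    have h3 := hχM (M₁ ++ s :: M₂) t M₃ (by simp)
    simp only [List.length_append, List.length_cons] at h1 h2 h3 hab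
    refine bool_eq_iff_odd (l := 1) h2 h3 (by simp) ?_
    have h4 := h1.symm.trans hab
    simp only [Nat.odd_iff, Nat.even_iff] at *
    omega
  have hMC : ∀ s Z t, s ∈ M → t ∈ D →
      IsEar G (D ∪ {x | x ∈ M}) s Z t → (χ' s = χ' t ↔ Odd Z.length) := by
    intro s Z t hs ht hZ
    obtain ⟨M₁, M₂, rfl⟩ := List.append_of_mem hs
    have h2 := hχM M₁ s _ rfl
    have h4 := hχ t (fun h => hMD t h ht)
    by_cases hta : t = a
    · have h5 : IsEar G (D ∪ {x | x ∈ M₂.reverse ++ s :: M₁.reverse}) s Z t := by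
        convert hZ using 3
        ext; simp; tauto
      have h6 := hM.reverse
      simp only [List.reverse_append, List.reverse_cons, List.append_assoc, List.cons_append,
        List.nil_append] at h6
      have h1 := h (h6.graft h5 ht (by rw [hta]; exact hM.ne))
      simp only [List.length_append, List.length_cons, List.length_reverse] at h1 hab
      subst hta
      rw [h4]
      refine bool_eq_iff_odd (A := χ t) (B := χ t) (l := 1) (j := 1) h2 (by simp) (by simp) ?_
      have h7 := (eq_comm.trans h1).symm.trans hab
      simp only [Nat.odd_iff, Nat.even_iff] at *
      omega
    · have h1 := h (hM.graft hZ ht hta)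
      simp only [List.length_append, List.length_cons] at h1 hab
      rw [h4]
      refine bool_eq_iff_odd (j := 1) h2 (by simp) h1 ?_
      simp only [Nat.odd_iff, Nat.even_iff] at *
      omega
  refine ⟨χ', fun s Z t hZ => ?_⟩
  rcases hZ.left with hs | hs <;> rcases hZ.right with ht | ht
  · rw [hχ s (fun h => hMD s h hs), hχ t (fun h => hMD t h ht)]
    exact h ⟨hs, ht, hZ.ne, fun x hx => fun hD => hZ.outside x hx (Or.inl hD), hZ.nodup, hZ.chain⟩
  · have := hMC t _ s ht hs hZ.reverse
    simpa [eq_comm] using this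
  · exact hMC s _ t hs ht hZ
  · obtain ⟨M₁, M₂, rfl⟩ := List.append_of_mem (show s ∈ M from hs)
    have ht' : t ∈ M₁ ++ s :: M₂ := ht
    rw [List.mem_append, List.mem_cons] at ht'
    rcases ht' with ht' | ht' | ht'
    · obtain ⟨N₁, N₂, rfl⟩ := List.append_of_mem ht'
      have := hMM t _ s N₁ N₂ M₂ (by simp) hZ.reverse
      simpa [eq_comm] using this
    · exact absurd ht'.symm hZ.ne
    · obtain ⟨N₁, N₂, rfl⟩ := List.append_of_mem ht'
      exact hMM s _ t M₁ N₁ N₂ rfl hZ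

theorem EarConsistent.exists_maximal [Finite V] {C : Set V} {χ : V → Bool}
    (h : EarConsistent G C χ) :
    ∃ (D : Set V) (χ' : V → Bool), C ⊆ D ∧ EarConsistent G D χ' ∧
      ∀ ⦃a M b⦄, IsEar G D a M b → M = [] := by
  obtain ⟨D, hCD, hD⟩ := (Set.toFinite {D : Set V | C ⊆ D ∧ ∃ χ', EarConsistent G D χ'}).exists_le_maximal
    (a := C) ⟨le_rfl, χ, h⟩
  obtain ⟨χ', hχ'⟩ := hD.prop.2
  refine ⟨D, χ', hCD, hχ', fun a M b hM => ?_⟩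
  by_contra hne
  obtain ⟨x, hx⟩ := List.exists_mem_of_ne_nil M hne
  have h1 := hD.le_of_ge (y := D ∪ {x | x ∈ M})
    ⟨hD.prop.1.trans Set.subset_union_left, hχ'.exists_extend hM⟩ Set.subset_union_left
  exact hM.outside x hx (h1 (Or.inr hx))

end Ears

set_option linter.unusedSectionVars false

section Counting

variable {V : Type*} [DecidableEq V] (G : SimpleGraph V) [DecidableRel G.Adj]

/-- The number of neighbours of `v` in `T`. -/
def SimpleGraph.degIn (v : V) (T : Finset V) : ℕ := (T.filter (G.Adj v)).card

/-- The number of ordered adjacent pairs in `S × T`. -/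
def SimpleGraph.pairCount (S T : Finset V) : ℕ := ∑ v ∈ S, G.degIn v T

namespace SimpleGraph

variable {G}

theorem degIn_le_card (v : V) (T : Finset V) : G.degIn v T ≤ T.card :=
  Finset.card_filter_le _ _

theorem degIn_mono (v : V) {T T' : Finset V} (h : T ⊆ T') : G.degIn v T ≤ G.degIn v T' :=
  Finset.card_le_card (Finset.filter_subset_filter _ h)

theorem degIn_union (v : V) {S T : Finset V} (h : Disjoint S T) :
    G.degIn v (S ∪ T) = G.degIn v S + G.degIn v T := by
  rw [degIn, Finset.filter_union, Finset.card_union_of_disjoint (Finset.disjoint_filter_filter h)]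
  rfl

theorem degIn_eq_zero {v : V} {T : Finset V} (h : ∀ w ∈ T, ¬ G.Adj v w) : G.degIn v T = 0 := by
  simpa [degIn, Finset.filter_eq_empty_iff] using h

theorem exists_adj_of_card_lt_degIn {v : V} {T F : Finset V} (h : F.card < G.degIn v T) :
    ∃ w ∈ T, w ∉ F ∧ G.Adj v w := by
  obtain ⟨w, hw, hF⟩ := Finset.exists_mem_notMem_of_card_lt_card h
  rw [Finset.mem_filter] at hw
  exact ⟨w, hw.1, hF, hw.2⟩

theorem degIn_self_lt {v : V} {T : Finset V} (h : v ∈ T) : G.degIn v T < T.card :=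
  Finset.card_lt_card (Finset.filter_ssubset.2 ⟨v, h, by simp⟩)

theorem pairCount_eq_sum (S T : Finset V) :
    G.pairCount S T = ∑ v ∈ S, ∑ w ∈ T, if G.Adj v w then 1 else 0 := by
  simp [pairCount, degIn]

theorem pairCount_comm (S T : Finset V) : G.pairCount S T = G.pairCount T S := by
  rw [pairCount_eq_sum, pairCount_eq_sum, Finset.sum_comm]
  simp [G.adj_comm]

theorem pairCount_union_left {S S' : Finset V} (h : Disjoint S S') (T : Finset V) :
    G.pairCount (S ∪ S') T = G.pairCount S T + G.pairCount S' T :=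
  Finset.sum_union h

theorem pairCount_union_right (S : Finset V) {T T' : Finset V} (h : Disjoint T T') :
    G.pairCount S (T ∪ T') = G.pairCount S T + G.pairCount S T' := by
  rw [pairCount_comm, pairCount_union_left h, pairCount_comm T, pairCount_comm T']

theorem pairCount_singleton_left (v : V) (T : Finset V) : G.pairCount {v} T = G.degIn v T := by
  simp [pairCount]

theorem pairCount_le {S T : Finset V} {d : ℕ} (h : ∀ v ∈ S, G.degIn v T ≤ d) :
    G.pairCount S T ≤ S.card * d :=
  Finset.sum_le_card_nsmul _ _ _ h

theorem pairCount_le_mul (S T : Finset V) : G.pairCount S T ≤ S.card * T.card :=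
  pairCount_le fun _ _ => degIn_le_card _ _

theorem pairCount_self_union {S T : Finset V} (h : Disjoint S T) :
    G.pairCount (S ∪ T) (S ∪ T) =
      G.pairCount S S + 2 * G.pairCount S T + G.pairCount T T := by
  rw [pairCount_union_left h, pairCount_union_right _ h, pairCount_union_right _ h,
    pairCount_comm T S]
  ring

theorem pairCount_self_le (S : Finset V) : G.pairCount S S ≤ S.card * (S.card - 1) :=
  pairCount_le fun _ hv => Nat.le_sub_one_of_lt (degIn_self_lt hv)

theorem pairCount_univ [Fintype V] : G.pairCount Finset.univ Finset.univ = 2 * G.edgeSet.ncard := by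
  rw [Set.ncard_eq_toFinset_card', ← SimpleGraph.edgeFinset, ← G.sum_degrees_eq_twice_card_edges]
  refine Finset.sum_congr rfl fun v _ => ?_
  rw [degIn, ← G.card_neighborFinset_eq_degree, neighborFinset_eq_filter]

theorem exists_isChain_of_le_degIn {S : Finset V} (hS : S.Nonempty) {L : ℕ}
    (h : ∀ v ∈ S, L ≤ G.degIn v S) (m : ℕ) (hm : m ≤ L) :
    ∃ v l, (v :: l).Nodup ∧ (∀ x ∈ v :: l, x ∈ S) ∧ List.IsChain G.Adj (v :: l) ∧
      l.length = m := by
  induction m with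
  | zero =>
    obtain ⟨v, hv⟩ := hS
    exact ⟨v, [], by simp, by simpa using hv, by simp, rfl⟩
  | succ m ih =>
    obtain ⟨v, l, h1, h2, h3, rfl⟩ := ih (by omega)
    have h4 := h v (h2 v (by simp))
    have h5 : l.toFinset.card ≤ l.length := List.toFinset_card_le l
    obtain ⟨w, hw, hwl, hvw⟩ := exists_adj_of_card_lt_degIn (G := G) (F := l.toFinset) (v := v) (T := S)
      (by omega)
    refine ⟨w, v :: l, ?_, ?_, ?_, rfl⟩
    · rw [List.nodup_cons]
      refine ⟨?_, h1⟩
      simp only [List.mem_toFinset] at hwl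
      simp [hwl, hvw.ne']
    · simpa [hw] using h2
    · rw [List.isChain_cons_cons]
      exact ⟨hvw.symm, h3⟩

/-- A graph with many edges inside `S` contains a long path inside `S`. -/
theorem pairCount_self_le_of_no_path {L : ℕ} (S : Finset V)
    (h : ∀ v l, (v :: l).Nodup → (∀ x ∈ v :: l, x ∈ S) → List.IsChain G.Adj (v :: l) →
      l.length ≠ L) :
    G.pairCount S S ≤ 2 * L * S.card := by
  induction hn : S.card generalizing S with
  | zero => simp [Finset.card_eq_zero.1 hn, pairCount]
  | succ n ih =>
    obtain ⟨v, hv, hd⟩ : ∃ v ∈ S, G.degIn v S < L := by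
      by_contra! hcon
      obtain ⟨v, l, h1, h2, h3, h4⟩ := exists_isChain_of_le_degIn
        (Finset.card_pos.1 (by omega)) hcon L le_rfl
      exact h v l h1 h2 h3 h4
    have hcard := Finset.card_erase_of_mem hv
    have h1 := ih (S.erase v) (fun w l hn hS hc => h w l hn
      (fun x hx => Finset.mem_of_mem_erase (hS x hx)) hc) (by omega)
    have h2 : S = {v} ∪ S.erase v := by ext; simp; grind
    have h3 : G.degIn v (S.erase v) ≤ G.degIn v S := degIn_mono v (Finset.erase_subset _ _)
    rw [h2, pairCount_self_union (by simp), pairCount_singleton_left, pairCount_singleton_left]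
    have h4 : G.degIn v {v} = 0 := degIn_eq_zero (by simp)
    rw [h4]
    nlinarith

/-- In a graph without `C_{L+2}`, neighbourhoods span few edges. -/
theorem CycleFree.pairCount_neighbors_le {L : ℕ} (hL : 1 ≤ L) (hf : G.CycleFree (L + 2)) {u : V}
    {A : Finset V} (hA : ∀ x ∈ A, G.Adj u x) : G.pairCount A A ≤ 2 * L * A.card := by
  refine pairCount_self_le_of_no_path A fun v l hn hS hc hl => ?_
  have hu : u ∉ v :: l := fun hu => (G.irrefl (hA u (hS u hu)))
  refine hf.false_of_closed_chain (a := u) (L := v :: l) (by omega) ?_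
    (List.nodup_cons.2 ⟨hu, hn⟩) (by simp; omega)
  rw [List.cons_append, List.isChain_cons_cons, ← List.cons_append]
  refine ⟨hA v (hS v (by simp)), ?_⟩
  rw [List.isChain_append]
  refine ⟨hc, by simp, fun x hx y hy => ?_⟩
  simp only [List.head?_cons, Option.mem_def, Option.some.injEq] at hy
  subst hy
  exact (hA x (hS x (List.mem_of_mem_getLast? hx))).symm

end SimpleGraph

end Counting

section Cuts

variable {V : Type*} [Fintype V] [DecidableEq V] {G : SimpleGraph V} [DecidableRel G.Adj]

namespace SimpleGraph

/-- A graph without `C_{L+2}` has a large cut: the neighbourhood of a vertex of maximum degree. -/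
theorem CycleFree.exists_large_cut [Nonempty V] {L : ℕ} (hL : 1 ≤ L) (hf : G.CycleFree (L + 2)) :
    ∃ A : Finset V,
      4 * G.pairCount .univ .univ ≤ 4 * G.pairCount A Aᶜ + (Fintype.card V + 2 * L) ^ 2 := by
  obtain ⟨u, -, hu⟩ := Finset.exists_max_image Finset.univ (fun v => G.degIn v .univ)
    Finset.univ_nonempty
  refine ⟨Finset.univ.filter (G.Adj u), ?_⟩
  set A := Finset.univ.filter (G.Adj u) with hA
  have h1 := hf.pairCount_neighbors_le hL (u := u) (A := A) (by simp [hA])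
  have h2 : G.pairCount Aᶜ .univ ≤ Aᶜ.card * A.card := pairCount_le fun v _ => hu v (by simp)
  have h3 : G.pairCount Aᶜ .univ = G.pairCount A Aᶜ + G.pairCount Aᶜ Aᶜ := by
    rw [← Finset.union_compl A, pairCount_union_right _ disjoint_compl_right, pairCount_comm]
  have h4 : G.pairCount .univ .univ =
      G.pairCount A A + 2 * G.pairCount A Aᶜ + G.pairCount Aᶜ Aᶜ := by
    rw [← Finset.union_compl A, pairCount_self_union disjoint_compl_right]
  have h5 : Fintype.card V = A.card + Aᶜ.card := (Finset.card_add_card_compl A).symm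
  rw [h5]
  zify at *
  nlinarith [sq_nonneg ((A.card : ℤ) - Aᶜ.card - 2 * L)]

theorem degIn_le_degIn_compl_of_max_cut {A : Finset V}
    (h : ∀ A' : Finset V, G.pairCount A' A'ᶜ ≤ G.pairCount A Aᶜ) {a : V} (ha : a ∈ A) :
    G.degIn a A ≤ G.degIn a Aᶜ := by
  have h1 := h (A.erase a)
  have h2 : (A.erase a)ᶜ = {a} ∪ Aᶜ := by ext; simp
  have h3 : A = {a} ∪ A.erase a := by ext; simp; grind
  have h4 : G.pairCount A Aᶜ = G.degIn a Aᶜ + G.pairCount (A.erase a) Aᶜ :=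
    (Finset.add_sum_erase A (fun v => G.degIn v Aᶜ) ha).symm
  rw [h4, h2, pairCount_union_right _ (by simpa using ha), pairCount_comm _ {a},
    pairCount_singleton_left] at h1
  have h5 : G.degIn a A = G.degIn a {a} + G.degIn a (A.erase a) := by
    conv_lhs => rw [h3]
    rw [degIn_union _ (by simp)]
  have h6 : G.degIn a {a} = 0 := degIn_eq_zero (by simp)
  omega

theorem exists_max_cut (G : SimpleGraph V) [DecidableRel G.Adj] :
    ∃ A : Finset V, (∀ A' : Finset V, G.pairCount A' A'ᶜ ≤ G.pairCount A Aᶜ) ∧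
      (∀ a ∈ A, G.degIn a A ≤ G.degIn a Aᶜ) ∧ (∀ b ∈ Aᶜ, G.degIn b Aᶜ ≤ G.degIn b A) := by
  obtain ⟨A, -, hA⟩ := Finset.exists_max_image (Finset.univ : Finset (Finset V))
    (fun A => G.pairCount A Aᶜ) Finset.univ_nonempty
  refine ⟨A, fun A' => hA A' (by simp), fun a ha => ?_, fun b hb => ?_⟩
  · exact degIn_le_degIn_compl_of_max_cut (fun A' => hA A' (by simp)) ha
  · have := degIn_le_degIn_compl_of_max_cut (G := G) (A := Aᶜ) (fun A' => by
      rw [compl_compl, pairCount_comm Aᶜ]; exact hA A' (by simp)) hb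
    rwa [compl_compl] at this

/-- A weighted density: vertices are worth keeping when their density to the other side is at least
`27/50`. -/
def coreWeight (G : SimpleGraph V) [DecidableRel G.Adj] (a b : ℕ) (X Y : Finset V) : ℤ :=
  50 * G.pairCount X Y - 27 * b * X.card - 27 * a * Y.card

theorem coreWeight_swap (a b : ℕ) (X Y : Finset V) :
    G.coreWeight a b X Y = G.coreWeight b a Y X := by
  rw [coreWeight, coreWeight, pairCount_comm]
  ring

theorem coreWeight_cons (a b : ℕ) {x : V} {X : Finset V} (hx : x ∉ X) (Y : Finset V) :
    G.coreWeight a b (insert x X) Y = G.coreWeight a b X Y + 50 * G.degIn x Y - 27 * b := by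
  rw [coreWeight, coreWeight, Finset.insert_eq, pairCount_union_left (by simpa using hx),
    pairCount_singleton_left, Finset.card_union_of_disjoint (by simpa using hx)]
  push_cast [Finset.card_singleton]
  ring

/-- The four degree conditions and the density bound satisfied by a pair of maximum weight. -/
structure IsCore (G : SimpleGraph V) [DecidableRel G.Adj] (A B X Y : Finset V) : Prop where
  subset_left : X ⊆ A
  subset_right : Y ⊆ B
  left : ∀ x ∈ X, 27 * B.card ≤ 50 * G.degIn x Y
  right : ∀ y ∈ Y, 27 * A.card ≤ 50 * G.degIn y X
  outside_left : ∀ x ∈ A \ X, 50 * G.degIn x Y ≤ 27 * B.card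
  outside_right : ∀ y ∈ B \ Y, 50 * G.degIn y X ≤ 27 * A.card
  weight : G.coreWeight A.card B.card A B ≤ G.coreWeight A.card B.card X Y
  card_left : 64 * A.card ≤ 100 * X.card
  card_right : 64 * B.card ≤ 100 * Y.card

theorem core_card_bound {A B X Y : Finset V} (hX : X ⊆ A)
    (hYB : Y ⊆ B) (hX' : 54 * A.card ≤ 100 * X.card)
    (hw : G.coreWeight A.card B.card A B ≤ G.coreWeight A.card B.card X Y)
    (hd : 8392 * (A.card * B.card) ≤ 10000 * G.pairCount A B) (hB : 0 < B.card) :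
    64 * A.card ≤ 100 * X.card := by
  have h1 := pairCount_le_mul (G := G) X Y
  have h2 := Finset.card_le_card hX
  have h3 := Finset.card_le_card hYB
  simp only [coreWeight] at hw
  zify at *
  generalize (A.card : ℤ) = a at *
  generalize (B.card : ℤ) = b at *
  generalize (X.card : ℤ) = x at *
  generalize (Y.card : ℤ) = y at *
  have h5 : 50 * (8392 * (a * b)) - 10000 * (54 * (a * b)) ≤
      10000 * (50 * (x * y) - 27 * b * x - 27 * a * y) := by linarith
  have h6 : 0 ≤ (b - y) * (100 * x - 54 * a) :=
    mul_nonneg (by linarith) (by linarith)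
  have h7 : 0 ≤ b * (100 * x - 64 * a) := by nlinarith
  have := nonneg_of_mul_nonneg_right h7 hB
  linarith

theorem exists_isCore {A B : Finset V} (hA : 10 ≤ A.card) (hB : 10 ≤ B.card)
    (hd : 8392 * (A.card * B.card) ≤ 10000 * G.pairCount A B) :
    ∃ X Y, IsCore G A B X Y := by
  obtain ⟨⟨X, Y⟩, hXY, hmax⟩ := Finset.exists_max_image
    ((A.powerset ×ˢ B.powerset).filter
      fun P => 54 * A.card ≤ 100 * P.1.card ∧ 54 * B.card ≤ 100 * P.2.card)
    (fun P => G.coreWeight A.card B.card P.1 P.2) ⟨(A, B), by simp; omega⟩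
  simp only [Finset.mem_filter, Finset.mem_product, Finset.mem_powerset, and_imp, Prod.forall]
    at hXY hmax
  obtain ⟨⟨hX, hY⟩, hXc, hYc⟩ := hXY
  have hw := hmax A B subset_rfl subset_rfl (by omega) (by omega)
  have hXs := core_card_bound hX hY hXc hw hd (by omega)
  have hYs := core_card_bound (G := G) hY hX hYc
    (by rw [coreWeight_swap, coreWeight_swap _ _ Y X]; exact hw)
    (by rw [pairCount_comm, mul_comm B.card]; exact hd) (by omega)
  refine ⟨X, Y, hX, hY, fun x hx => ?_, fun y hy => ?_, fun x hx => ?_, fun y hy => ?_, hw, hXs, hYs⟩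
  · have hc := Finset.card_erase_of_mem hx
    have h1 := hmax (X.erase x) Y ((Finset.erase_subset _ _).trans hX) hY (by omega) hYc
    have h2 := coreWeight_cons (G := G) A.card B.card (Finset.notMem_erase x X) Y
    rw [Finset.insert_erase hx] at h2
    omega
  · have hc := Finset.card_erase_of_mem hy
    have h1 := hmax X (Y.erase y) hX ((Finset.erase_subset _ _).trans hY) hXc (by omega)
    have h2 := coreWeight_cons (G := G) B.card A.card (Finset.notMem_erase y Y) X
    rw [Finset.insert_erase hy, coreWeight_swap, coreWeight_swap _ _ (Y.erase y)] at h2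
    omega
  · rw [Finset.mem_sdiff] at hx
    have h1 := hmax (insert x X) Y (Finset.insert_subset hx.1 hX) hY
      (by rw [Finset.card_insert_of_notMem hx.2]; omega) hYc
    have h2 := coreWeight_cons (G := G) A.card B.card hx.2 Y
    omega
  · rw [Finset.mem_sdiff] at hy
    have h1 := hmax X (insert y Y) hX (Finset.insert_subset hy.1 hY) hXc
      (by rw [Finset.card_insert_of_notMem hy.2]; omega)
    have h2 := coreWeight_cons (G := G) B.card A.card hy.2 X
    rw [coreWeight_swap, coreWeight_swap _ _ Y] at h2
    omega

theorem exists_common_neighbor {Y F : Finset V} {u v : V}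
    (h : Y.card + F.card < G.degIn u Y + G.degIn v Y) :
    ∃ y ∈ Y, y ∉ F ∧ G.Adj u y ∧ G.Adj v y := by
  have h1 := Finset.card_union_add_card_inter (Y.filter (G.Adj u)) (Y.filter (G.Adj v))
  have h2 : (Y.filter (G.Adj u) ∪ Y.filter (G.Adj v)).card ≤ Y.card :=
    Finset.card_le_card (by grind)
  obtain ⟨y, hy, hF⟩ := Finset.exists_mem_notMem_of_card_lt_card (s := F)
    (t := Y.filter (G.Adj u) ∩ Y.filter (G.Adj v)) (by simp only [degIn] at h; omega)
  simp only [Finset.mem_inter, Finset.mem_filter] at hy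
  exact ⟨y, hy.1.1, hF, hy.1.2, hy.2.2⟩

end SimpleGraph

end Cuts

section Rich

variable {V : Type*} [DecidableEq V] {G : SimpleGraph V}

/-- Any two vertices of `C` of the same colour have more than `K` common neighbours of the other
colour in `C`. -/
def IsRich (G : SimpleGraph V) (C : Finset V) (χ : V → Bool) (K : ℕ) : Prop :=
  ∀ ⦃u⦄, u ∈ C → ∀ ⦃v⦄, v ∈ C → χ u = χ v → ∀ F : Finset V, F.card ≤ K →
    ∃ y ∈ C, y ∉ F ∧ χ y ≠ χ u ∧ G.Adj u y ∧ G.Adj v y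

namespace IsRich

variable {C : Finset V} {χ : V → Bool} {K k : ℕ}

theorem exists_path (h : IsRich G C χ K) {u v : V} (hu : u ∈ C) (hv : v ∈ C) (huv : u ≠ v)
    {m : ℕ} (hm : 1 ≤ m) (hp : χ u = χ v ↔ Odd m) (F : Finset V) (hvF : v ∉ F)
    (hF : F.card + m + 1 ≤ K) :
    ∃ M : List V, M.length = m ∧ (∀ x ∈ M, x ∈ C ∧ x ∉ F) ∧ (u :: (M ++ [v])).Nodup ∧
      List.IsChain G.Adj (u :: (M ++ [v])) := by
  induction m, hm using Nat.le_induction generalizing u F with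
  | base =>
    obtain ⟨y, hyC, hyF, -, huy, hvy⟩ := h hu hv (by simpa using hp) F (by omega)
    refine ⟨[y], rfl, by simp [hyC, hyF], ?_, ?_⟩
    · simp [huv, huy.ne, hvy.ne']
    · simp [huy, hvy.symm]
  | succ m hm ih =>
    obtain ⟨w, hwC, hwF, hχ, huw, -⟩ := h hu hu rfl (insert v F)
      ((Finset.card_insert_le _ _).trans (by omega))
    rw [Finset.mem_insert, not_or] at hwF
    have hp' : χ w = χ v ↔ Odd m := by
      rw [Nat.odd_add_one] at hp
      revert hp hχ
      cases χ w <;> cases χ v <;> cases χ u <;> simp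
    have hvF' : v ∉ insert u F := by simp [hvF, huv.symm]
    obtain ⟨M, h1, h2, h3, h4⟩ := ih hwC hwF.1 hp' (insert u F) hvF'
      (by have := Finset.card_insert_le u F; omega)
    refine ⟨w :: M, by simp [h1], ?_, ?_, ?_⟩
    · simp only [List.mem_cons, forall_eq_or_imp]
      exact ⟨⟨hwC, hwF.2⟩, fun x hx => ⟨(h2 x hx).1, by have := (h2 x hx).2; simp_all⟩⟩
    · rw [List.cons_append, List.nodup_cons]
      refine ⟨?_, h3⟩
      have : u ∉ M := fun hx => (h2 u hx).2 (by simp)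
      simp [huw.ne, huv, this]
    · rw [List.cons_append, List.isChain_cons_cons]
      exact ⟨huw, h4⟩

/-- In a `C_{2k+1}`-free graph, ears of a rich bipartite graph with the wrong parity are long. -/
theorem le_length_of_wrong (h : IsRich G C χ (2 * k)) (hk : 1 ≤ k)
    (hf : G.CycleFree (2 * k + 1)) {a b : V} {M : List V} (hM : IsEar G C a M b)
    (hp : χ a = χ b ↔ Even M.length) : 2 * k - 1 ≤ M.length := by
  by_contra! hlt
  have hpar : χ b = χ a ↔ Odd (2 * k - 1 - M.length) := by
    rw [eq_comm, hp, Nat.even_iff, Nat.odd_iff]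
    omega
  obtain ⟨N, h1, h2, h3, h4⟩ := h.exists_path hM.right hM.left hM.ne.symm (by omega) hpar ∅
    (by simp) (by simp; omega)
  refine hf.false_of_closed_chain (a := a) (L := M ++ b :: N) (by omega) ?_ ?_
    (by simp; omega)
  · rw [List.append_assoc, List.cons_append, List.isChain_cons_split]
    exact ⟨hM.chain, h4⟩
  · have h5 := hM.nodup
    have h6 := hM.outside
    have h7 := hM.ne
    have h8 := hM.left
    have h9 := hM.right
    simp only [Finset.mem_coe] at h6 h8 h9
    simp only [List.nodup_append, List.nodup_cons, List.mem_append, List.mem_cons] at h3 ⊢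
    grind

theorem adj_ne (h : IsRich G C χ (2 * k)) (hk : 2 ≤ k) (hf : G.CycleFree (2 * k + 1)) {a b : V}
    (ha : a ∈ C) (hb : b ∈ C) (hab : G.Adj a b) : χ a ≠ χ b := by
  intro hχ
  have := h.le_length_of_wrong (by omega) hf (a := a) (b := b) (M := [])
    ⟨ha, hb, hab.ne, by simp, by simp, by simpa using hab⟩ (by simp [hχ])
  simp at this
  omega

theorem eq_of_adj (h : IsRich G C χ (2 * k)) (hk : 2 ≤ k) (hf : G.CycleFree (2 * k + 1)) {a b x : V}
    (ha : a ∈ C) (hb : b ∈ C) (hx : x ∉ C) (hxa : G.Adj x a) (hxb : G.Adj x b) : χ a = χ b := by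
  by_contra hχ
  have := h.le_length_of_wrong (by omega) hf (a := a) (b := b) (M := [x])
    ⟨ha, hb, fun h => hχ (h ▸ rfl), by simpa using hx, by simp, by simp [hxa.symm, hxb]⟩
    (by simp [hχ])
  simp at this
  omega

end IsRich

end Rich

section RichCore

/-- The numerical heart of the estimate for the number of vertices outside a core. -/
theorem core_estimate {a b p q : ℝ} (hp : 0 ≤ p) (hq : 0 ≤ q) (ha : 0 < a) (hb : 0 < b)
    (hpa : 100 * p ≤ 36 * a) (hqb : 100 * q ≤ 36 * b)
    (h1 : 4802 * (a + b) ^ 2 ≤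
      10000 * (2 * ((a - p) * (b - q)) + 27 / 25 * (p * b + q * a) + (p + q) ^ 2))
    (h2 : 46 * (p * b + q * a) - 100 * (p * q) ≤ 100 * (a * b) - 20.98 * (a + b) ^ 2) :
    1000 * (p + q) ≤ 52 * (a + b) ∧ 100 * a ≤ 62 * (a + b) ∧ 100 * b ≤ 62 * (a + b) := by
  obtain ⟨n, hn⟩ : ∃ n, n = a + b := ⟨_, rfl⟩
  obtain ⟨s, hs⟩ : ∃ s, s = p + q := ⟨_, rfl⟩
  obtain ⟨z, hz⟩ : ∃ z, z = (a - b) / 2 := ⟨_, rfl⟩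
  obtain ⟨w, hw⟩ : ∃ w, w = p - q := ⟨_, rfl⟩
  obtain rfl : a = n / 2 + z := by linarith
  obtain rfl : b = n / 2 - z := by linarith
  obtain rfl : p = (s + w) / 2 := by linarith
  obtain rfl : q = (s - w) / 2 := by linarith
  clear hn hs hz hw
  have hn : 0 < n := by linarith
  have hs0 : 0 ≤ s := by linarith
  have hs : 100 * s ≤ 36 * n := by linarith
  have hpd : 7 / 10 * z ^ 2 ≤ z ^ 2 - 23 / 50 * z * w + w ^ 2 / 4 := by
    nlinarith [sq_nonneg (w / 2 - 23 / 50 * z), sq_nonneg z]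
  have f1 : 23 / 100 * s * n - 3 / 4 * s ^ 2 + (z ^ 2 - 23 / 50 * z * w + w ^ 2 / 4) ≤
      99 / 10000 * n ^ 2 := by nlinarith
  have f2 : 23 / 100 * s * n - s ^ 2 / 4 + (z ^ 2 - 23 / 50 * z * w + w ^ 2 / 4) ≤
      402 / 10000 * n ^ 2 := by nlinarith
  have hz2 := sq_nonneg z
  have hsn : 100 * s ≤ 24 * n := by
    by_contra! hcon
    nlinarith [mul_nonneg (sub_nonneg.2 hcon.le) (sub_nonneg.2 hs), mul_pos hn (sub_pos.2 hcon)]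
  have hsn' : 1000 * s ≤ 52 * n := by
    by_contra! hcon
    nlinarith [mul_nonneg (sub_nonneg.2 hcon.le) (sub_nonneg.2 hsn), mul_pos hn (sub_pos.2 hcon)]
  have hz3 : z ^ 2 ≤ (12 / 100 * n) ^ 2 := by
    nlinarith [mul_nonneg hs0 (sub_nonneg.2 hsn'), mul_nonneg hs0 hn.le]
  have hz4 := abs_le_of_sq_le_sq' hz3 (by linarith)
  refine ⟨by linarith, by linarith [hz4.2], by linarith [hz4.1]⟩

variable {V : Type*} [Fintype V] [DecidableEq V] {G : SimpleGraph V} [DecidableRel G.Adj]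

namespace SimpleGraph

theorem IsCore.isRich {A B X Y : Finset V} {K : ℕ} (h : IsCore G A B X Y) (hXY : Disjoint X Y)
    (hA : 25 * K < 2 * A.card) (hB : 25 * K < 2 * B.card) :
    IsRich G (X ∪ Y) (fun v => decide (v ∈ X)) K := by
  intro u hu v hv huv F hF
  have hYB := Finset.card_le_card h.subset_right
  have hXA := Finset.card_le_card h.subset_left
  rw [decide_eq_decide] at huv
  rw [Finset.mem_union] at hu hv
  rw [Finset.disjoint_left] at hXY
  by_cases huX : u ∈ X
  · have h1 := h.left u huX
    have h2 := h.left v (huv.1 huX)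
    obtain ⟨y, hy, hyF, hy1, hy2⟩ := exists_common_neighbor (G := G) (Y := Y) (F := F) (u := u)
      (v := v) (by omega)
    have : y ∉ X := fun hx => hXY hx hy
    exact ⟨y, by simp [hy], hyF, by simp [huX, this], hy1, hy2⟩
  · have hvX := fun hvX => huX (huv.2 hvX)
    have h1 := h.right u (hu.resolve_left huX)
    have h2 := h.right v (hv.resolve_left hvX)
    obtain ⟨y, hy, hyF, hy1, hy2⟩ := exists_common_neighbor (G := G) (Y := X) (F := F) (u := u)
      (v := v) (by omega)
    exact ⟨y, by simp [hy], hyF, by simp [huX, hy], hy1, hy2⟩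

theorem IsCore.degIn_le {A B X Y : Finset V} (h : IsCore G A B X Y) (hXY : Disjoint X Y)
    {v : V} (hv : v ∈ A \ X) (hone : G.degIn v X = 0 ∨ G.degIn v Y = 0)
    (hmax : G.degIn v A ≤ G.degIn v B) : 50 * G.degIn v (X ∪ Y) ≤ 27 * B.card := by
  rw [degIn_union v hXY]
  have h1 := h.outside_left v hv
  rcases hone with h0 | h0
  · omega
  · have h2 := degIn_mono (G := G) v h.subset_left
    have h3 : G.degIn v B = G.degIn v Y + G.degIn v (B \ Y) := by
      rw [← degIn_union v Finset.disjoint_sdiff, Finset.union_sdiff_of_subset h.subset_right]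
    have h4 := degIn_le_card (G := G) v (B \ Y)
    rw [Finset.card_sdiff_of_subset h.subset_right] at h4
    have := h.card_right
    omega

theorem IsCore.swap {A B X Y : Finset V} (h : IsCore G A B X Y) : IsCore G B A Y X where
  subset_left := h.subset_right
  subset_right := h.subset_left
  left := h.right
  right := h.left
  outside_left := h.outside_right
  outside_right := h.outside_left
  weight := by rw [coreWeight_swap, coreWeight_swap _ _ Y X]; exact h.weight
  card_left := h.card_right
  card_right := h.card_left

/-- A dense `C_{2k+1}`-free graph has a rich bipartite part containing almost all vertices. -/
theorem CycleFree.exists_isRich {k : ℕ} (hk : 2 ≤ k) (hn : 100 * k ≤ Fintype.card V)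
    (hf : G.CycleFree (2 * k + 1))
    (he : 4802 * Fintype.card V ^ 2 ≤ 10000 * G.pairCount .univ .univ) :
    ∃ (C : Finset V) (χ : V → Bool), IsRich G C χ (2 * k) ∧
      1000 * Cᶜ.card ≤ 52 * Fintype.card V ∧
      ∀ v ∈ Cᶜ, 100 * G.degIn v C ≤ 34 * Fintype.card V := by
  have : Nonempty V := Fintype.card_pos_iff.1 (by omega)
  obtain ⟨A₀, hA₀⟩ := CycleFree.exists_large_cut (G := G) (L := 2 * k - 1) (by omega)
    (by convert hf using 1; omega)
  obtain ⟨A, hmax, hdA, hdB⟩ := G.exists_max_cut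
  have hcut := hmax A₀
  obtain ⟨B, hB⟩ : ∃ B, B = Aᶜ := ⟨_, rfl⟩
  rw [← hB] at hdA hdB hcut
  have hAB : Disjoint A B := hB ▸ disjoint_compl_right
  have hcard : Fintype.card V = A.card + B.card := hB ▸ (Finset.card_add_card_compl A).symm
  have hcd : 2098 * Fintype.card V ^ 2 ≤ 10000 * G.pairCount A B := by
    have h1 : (Fintype.card V + 2 * (2 * k - 1)) ^ 2 * 10000 ≤ (104 * Fintype.card V) ^ 2 := by
      have : 100 * (Fintype.card V + 2 * (2 * k - 1)) ≤ 104 * Fintype.card V := by omega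
      have := Nat.pow_le_pow_left this 2
      linarith
    linarith
  have hle := pairCount_le_mul (G := G) A B
  rw [hcard] at hcd hn he ⊢
  have hA : 299 * (A.card + B.card) ≤ 1000 * A.card := by
    zify at *
    by_contra! hcon
    nlinarith
  have hBc : 299 * (A.card + B.card) ≤ 1000 * B.card := by
    zify at *
    by_contra! hcon
    nlinarith
  obtain ⟨X, Y, hcore⟩ := exists_isCore (G := G) (A := A) (B := B) (by omega) (by omega)
    (by zify at *; nlinarith [sq_nonneg ((A.card : ℤ) - B.card)])
  have hXY : Disjoint X Y :=
    Finset.disjoint_of_subset_left hcore.subset_left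
      (Finset.disjoint_of_subset_right hcore.subset_right hAB)
  have hrich := hcore.isRich (K := 2 * k) hXY (by omega) (by omega)
  have hC : (X ∪ Y)ᶜ = A \ X ∪ B \ Y := by
    have h1 := hcore.subset_left
    have h2 := hcore.subset_right
    ext v
    have h3 := @h1 v
    have h4 := @h2 v
    subst hB
    simp only [Finset.mem_compl, Finset.mem_union, Finset.mem_sdiff] at *
    tauto
  have hAC : Disjoint (A \ X) (B \ Y) :=
    Finset.disjoint_of_subset_left Finset.sdiff_subset
      (Finset.disjoint_of_subset_right Finset.sdiff_subset hAB)
  have hnot : ∀ x y : V, x ∈ X → y ∈ Y → decide (x ∈ X) ≠ decide (y ∈ X) := by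
    intro x y hx hy
    simp [hx, Finset.disjoint_right.1 hXY hy]
  have hone : ∀ v ∈ (X ∪ Y)ᶜ, G.degIn v X = 0 ∨ G.degIn v Y = 0 := by
    intro v hv
    by_contra! hcon
    obtain ⟨x, hx, -, hvx⟩ := exists_adj_of_card_lt_degIn (F := ∅) (Nat.pos_of_ne_zero hcon.1)
    obtain ⟨y, hy, -, hvy⟩ := exists_adj_of_card_lt_degIn (F := ∅) (Nat.pos_of_ne_zero hcon.2)
    exact hnot x y hx hy (hrich.eq_of_adj hk hf (by simp [hx]) (by simp [hy])
      (Finset.mem_compl.1 hv) hvx hvy)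
  have hdegA : ∀ v ∈ A \ X, 50 * G.degIn v (X ∪ Y) ≤ 27 * B.card := fun v hv =>
    hcore.degIn_le hXY hv (hone v (by rw [hC]; exact Finset.mem_union_left _ hv))
      (hdA v (Finset.mem_sdiff.1 hv).1)
  have hdegB : ∀ v ∈ B \ Y, 50 * G.degIn v (X ∪ Y) ≤ 27 * A.card := fun v hv => by
    rw [Finset.union_comm]
    exact hcore.swap.degIn_le hXY.symm hv
      (hone v (by rw [hC]; exact Finset.mem_union_right _ hv)).symm
      (hdB v (Finset.mem_sdiff.1 hv).1)
  have hpA : (A \ X).card + X.card = A.card := Finset.card_sdiff_add_card_eq_card hcore.subset_left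
  have hpB : (B \ Y).card + Y.card = B.card := Finset.card_sdiff_add_card_eq_card hcore.subset_right
  have hXX : G.pairCount X X = 0 := Finset.sum_eq_zero fun v hv => degIn_eq_zero fun w hw hvw =>
    hrich.adj_ne hk hf (by simp [hv]) (by simp [hw]) hvw (by simp [hv, hw])
  have hYY : G.pairCount Y Y = 0 := Finset.sum_eq_zero fun v hv => degIn_eq_zero fun w hw hvw =>
    hrich.adj_ne hk hf (by simp [hv]) (by simp [hw]) hvw
      (by simp [Finset.disjoint_right.1 hXY hv, Finset.disjoint_right.1 hXY hw])
  have hXYm := pairCount_le_mul (G := G) X Y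
  have hTT := pairCount_le_mul (G := G) (X ∪ Y)ᶜ (X ∪ Y)ᶜ
  have hTA : 50 * G.pairCount (A \ X) (X ∪ Y) ≤ (A \ X).card * (27 * B.card) := by
    rw [pairCount, Finset.mul_sum]
    exact Finset.sum_le_card_nsmul _ _ _ hdegA
  have hTB : 50 * G.pairCount (B \ Y) (X ∪ Y) ≤ (B \ Y).card * (27 * A.card) := by
    rw [pairCount, Finset.mul_sum]
    exact Finset.sum_le_card_nsmul _ _ _ hdegB
  have htot : G.pairCount .univ .univ = 2 * G.pairCount X Y +
      2 * (G.pairCount (A \ X) (X ∪ Y) + G.pairCount (B \ Y) (X ∪ Y)) +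
      G.pairCount (X ∪ Y)ᶜ (X ∪ Y)ᶜ := by
    rw [← Finset.union_compl (X ∪ Y), pairCount_self_union disjoint_compl_right,
      pairCount_self_union hXY, hXX, hYY, pairCount_comm _ (X ∪ Y)ᶜ, ← pairCount_union_left hAC,
      ← hC]
    ring
  have ht : (X ∪ Y)ᶜ.card = (A \ X).card + (B \ Y).card := by
    rw [hC, Finset.card_union_of_disjoint hAC]
  have hw := hcore.weight
  have hcl := hcore.card_left
  have hcr := hcore.card_right
  simp only [coreWeight] at hw
  have hest := core_estimate (a := A.card) (b := B.card) (p := (A \ X).card) (q := (B \ Y).card)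
    (by positivity) (by positivity) (by norm_cast; omega) (by norm_cast; omega)
    (by norm_cast; omega) (by norm_cast; omega) (by
      rify at *
      rw [ht] at hTT
      rw [show (A.card : ℝ) - (A \ X).card = X.card by linarith,
        show (B.card : ℝ) - (B \ Y).card = Y.card by linarith]
      linarith) (by
      rify at *
      rw [show (X.card : ℝ) = A.card - (A \ X).card by linarith,
        show (Y.card : ℝ) = B.card - (B \ Y).card by linarith] at hw hXYm
      linarith)
  norm_cast at hest
  refine ⟨X ∪ Y, _, hrich, by omega, fun v hv => ?_⟩
  rw [hC, Finset.mem_union] at hv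
  rcases hv with hv | hv
  · have := hdegA v hv
    omega
  · have := hdegB v hv
    omega

end SimpleGraph

end RichCore

section WrongEar

theorem ear_count_contradiction {n k j D q e : ℕ} (hk : 2 ≤ k) (hn : 100 * k ≤ n)
    (hj : 1000 * j ≤ 52 * n) (hD : 100 * D ≤ 34 * n) (hq : 4 * q ≤ (n + 1 - 2 * k - j) ^ 2)
    (hE : 2 * e ≤ 2 * q + 2 * (j * D) + (2 * k + j) * (2 * k + j - 1))
    (hE0 : j = 0 → 2 * e < 2 * q + 2 * k * (2 * k - 1))
    (he : (n - 2 * k + 1) ^ 2 / 4 + (2 * k).choose 2 ≤ e) : False := by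
  have hch : (2 * k).choose 2 = k * (2 * k - 1) := by
    rw [Nat.choose_two_right, mul_assoc, Nat.mul_div_cancel_left _ (by norm_num)]
  rw [hch] at he
  obtain ⟨N, hN⟩ : ∃ N, n + 1 = N + 2 * k := ⟨n + 1 - 2 * k, by omega⟩
  rw [show n - 2 * k + 1 = N by omega] at he
  rw [show n + 1 - 2 * k - j = N - j by omega] at hq
  obtain ⟨l, hl⟩ : ∃ l, l + 1 = 2 * k := ⟨2 * k - 1, by omega⟩
  rw [show 2 * k - 1 = l by omega] at he hE0
  rw [show 2 * k + j - 1 = l + j by omega] at hE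
  have h1 := Nat.div_add_mod (N ^ 2) 4
  have h2 := Nat.mod_lt (N ^ 2) (show 0 < 4 by norm_num)
  rcases Nat.eq_zero_or_pos j with rfl | hj0
  · have := hE0 rfl
    simp only [Nat.sub_zero] at hq
    have h3 : q ≤ N ^ 2 / 4 := by omega
    nlinarith
  · have hjN : j ≤ N := by omega
    have h3 : N ^ 2 ≤ (N - j) ^ 2 + 4 * (j * D) + 8 * (j * k) + 2 * (j * j) + 3 := by
      nlinarith
    have h4 : 100 * N ≥ 98 * n := by omega
    obtain ⟨P, rfl⟩ := Nat.exists_eq_add_of_le hjN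
    rw [Nat.add_sub_cancel_left] at h3
    have h5 : j * (2 * P) ≤ j * (4 * D + 8 * k + j + 3) := by nlinarith
    have := Nat.le_of_mul_le_mul_left h5 hj0
    omega

variable {V : Type*} {G : SimpleGraph V}

theorem IsEar.truncate {D : Set V} {a b x z : V} {M₁ M₂ : List V}
    (h : IsEar G D a (M₁ ++ x :: M₂) b) (hz : z ∈ D) (hza : a ≠ z) (hxz : G.Adj x z) :
    IsEar G D a (M₁ ++ [x]) z where
  left := h.left
  right := hz
  ne := hza
  outside y hy := h.outside y (by simp only [List.mem_append, List.mem_cons] at hy ⊢; grind)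
  nodup := h.nodup.sublist (by simp)
  chain := by
    have h1 := h.chain
    rw [List.append_assoc, List.cons_append, List.isChain_cons_split] at h1 ⊢
    exact ⟨h1.1, by simpa using hxz⟩

theorem IsEar.truncate_left {D : Set V} {a b x z : V} {M₁ M₂ : List V}
    (h : IsEar G D a (M₁ ++ x :: M₂) b) (hz : z ∈ D) (hzb : z ≠ b) (hxz : G.Adj x z) :
    IsEar G D z (x :: M₂) b := by
  have h1 := h.reverse
  simp only [List.reverse_append, List.reverse_cons, List.append_assoc, List.cons_append,
    List.nil_append] at h1
  simpa using (h1.truncate hz hzb.symm hxz).reverse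

/-- An ear along which a colouring does not extend, of minimum length. -/
structure IsMinWrongEar (G : SimpleGraph V) (C : Set V) (χ : V → Bool) (a : V) (M : List V) (b : V) :
    Prop where
  isEar : IsEar G C a M b
  wrong : χ a = χ b ↔ Even M.length
  min : ∀ ⦃a' M' b'⦄, IsEar G C a' M' b' → M'.length < M.length →
    (χ a' = χ b' ↔ Odd M'.length)

theorem exists_isMinWrongEar {C : Set V} {χ : V → Bool} (h : ¬ EarConsistent G C χ) :
    ∃ a M b, IsMinWrongEar G C χ a M b := by
  classical
  have hex : ∃ m, ∃ a M b, IsEar G C a M b ∧ M.length = m ∧ ¬ (χ a = χ b ↔ Odd M.length) := by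
    simp only [EarConsistent, not_forall] at h
    obtain ⟨a, M, b, h1, h2⟩ := h
    exact ⟨_, a, M, b, h1, rfl, h2⟩
  obtain ⟨a, M, b, h1, h2, h3⟩ := Nat.find_spec hex
  refine ⟨a, M, b, h1, ?_, fun a' M' b' h4 h5 => ?_⟩
  · rw [← Nat.not_odd_iff_even]
    tauto
  · by_contra hcon
    exact Nat.find_min hex (h2 ▸ h5) ⟨a', M', b', h4, rfl, hcon⟩

namespace IsMinWrongEar

variable {C : Set V} {χ : V → Bool} {a b : V}

theorem eq_or_eq_of_adj {x z : V} {M₁ M₂ : List V}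
    (h : IsMinWrongEar G C χ a (M₁ ++ x :: M₂) b) (h₁ : M₁ ≠ []) (h₂ : M₂ ≠ []) (hz : z ∈ C)
    (hxz : G.Adj x z) : z = a ∨ z = b := by
  by_contra! hcon
  have hl₁ := List.length_pos_of_ne_nil h₁
  have hl₂ := List.length_pos_of_ne_nil h₂
  have h3 := h.min (h.isEar.truncate hz hcon.1.symm hxz) (by simp; omega)
  have h4 := h.min (h.isEar.truncate_left hz hcon.2 hxz) (by simp; omega)
  have h5 := h.wrong
  simp only [List.length_append, List.length_cons, List.length_nil] at h3 h4 h5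
  have h6 := bool_eq_iff_odd (l := M₂.length + 1) (z := M₁.length + M₂.length + 1) (i := 1) (j := M₁.length + 1)
    (S := χ b) (A := χ b) (T := χ a) (B := χ z) (by simp) h3 (by rw [eq_comm, h4])
    (by rw [Nat.even_iff]; omega)
  have h7 := h5.symm.trans (eq_comm.trans h6)
  rw [← add_assoc, ← Nat.not_odd_iff_even] at h7
  tauto

theorem not_adj_both {x : V} {M₁ M₂ : List V}
    (h : IsMinWrongEar G C χ a (M₁ ++ x :: M₂) b) (h₁ : M₁ ≠ []) (h₂ : M₂ ≠ [])
    (hxa : G.Adj x a) (hxb : G.Adj x b) : False := by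
  have hl₁ := List.length_pos_of_ne_nil h₁
  have hl₂ := List.length_pos_of_ne_nil h₂
  have h3 := h.min (h.isEar.truncate h.isEar.right h.isEar.ne hxb) (by simp; omega)
  have h4 := h.min (h.isEar.truncate_left h.isEar.left h.isEar.ne hxa) (by simp; omega)
  have h5 := h.min ((h.isEar.truncate_left h.isEar.left h.isEar.ne hxa).truncate (M₁ := [])
    h.isEar.right h.isEar.ne hxb) (by simp; omega)
  have h6 := h.wrong
  have hab : χ a = χ b := h5.2 (by simp)
  simp only [hab, List.length_append, List.length_cons, List.length_nil, true_iff,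
    Nat.odd_iff, Nat.even_iff] at h3 h4 h6
  omega

theorem degIn_le_one [DecidableEq V] [DecidableRel G.Adj] {C : Finset V} {x : V} {M₁ M₂ : List V}
    (h : IsMinWrongEar G C χ a (M₁ ++ x :: M₂) b) (h₁ : M₁ ≠ []) (h₂ : M₂ ≠ []) :
    G.degIn x C ≤ 1 := by
  rw [SimpleGraph.degIn, Finset.card_le_one]
  intro y hy z hz
  rw [Finset.mem_filter] at hy hz
  have := h.not_adj_both h₁ h₂
  rcases h.eq_or_eq_of_adj h₁ h₂ hy.1 hy.2 with rfl | rfl <;>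
  rcases h.eq_or_eq_of_adj h₁ h₂ hz.1 hz.2 with rfl | rfl
  · rfl
  · exact (this hy.2 hz.2).elim
  · exact (this hz.2 hy.2).elim
  · rfl

/-- Ends of a minimal wrong ear may be replaced by other neighbours of the same colours. -/
theorem replace {x y u v : V} {S : List V} (h : IsMinWrongEar G C χ a (x :: (S ++ [y])) b)
    (hu : u ∈ C) (hv : v ∈ C) (huv : u ≠ v) (hxu : G.Adj x u) (hyv : G.Adj y v)
    (hua : χ u = χ a) (hvb : χ v = χ b) : IsMinWrongEar G C χ u (x :: (S ++ [y])) v where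
  isEar := by
    refine ⟨hu, hv, huv, h.isEar.outside, h.isEar.nodup, ?_⟩
    have h1 := h.isEar.chain
    rw [List.cons_append, List.isChain_cons_cons, List.append_assoc, List.cons_append, ← List.cons_append,
      List.isChain_split] at h1 ⊢
    exact ⟨hxu.symm, h1.2.1, by simpa using hyv⟩
  wrong := by rw [hua, hvb]; exact h.wrong
  min := h.min

theorem not_adj_of_length_four {x₁ x₂ x₃ x₄ : V} {M : List V}
    (h : IsMinWrongEar G C χ a (x₁ :: x₂ :: x₃ :: x₄ :: M) b) : ¬ G.Adj x₁ x₄ := by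
  intro hadj
  have h1 : IsEar G C a (x₁ :: x₄ :: M) b := by
    refine ⟨h.isEar.left, h.isEar.right, h.isEar.ne, fun y hy => h.isEar.outside y ?_,
      h.isEar.nodup.sublist ?_, ?_⟩
    · simp only [List.mem_cons] at hy ⊢
      tauto
    · exact (((List.sublist_cons_self _ _).trans (List.sublist_cons_self _ _)).cons_cons _)
    · have := h.isEar.chain
      simp only [List.cons_append, List.isChain_cons_cons] at this ⊢
      tauto
  have h2 := h.min h1 (by simp)
  have h3 := h2.symm.trans h.wrong
  simp only [List.length_cons, Nat.odd_iff, Nat.even_iff] at h3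
  omega

end IsMinWrongEar

end WrongEar

section WrongEarCounting

variable {V : Type*} [DecidableEq V] {G : SimpleGraph V} [DecidableRel G.Adj]

namespace SimpleGraph

theorem _root_.Nat.add_le_one_add_mul {a b : ℕ} (ha : 1 ≤ a) (hb : 1 ≤ b) :
    a + b ≤ 1 + a * b := by
  obtain ⟨i, rfl⟩ := Nat.exists_eq_add_of_le ha
  obtain ⟨j, rfl⟩ := Nat.exists_eq_add_of_le hb
  nlinarith

theorem _root_.Nat.four_mul_mul_add_le (a b : ℕ) : 4 * (a * b + a) ≤ (a + b + 1) ^ 2 := by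
  zify
  nlinarith [sq_nonneg ((a : ℤ) - b - 1)]

theorem pairCount_le_add {C T U : Finset V} {D : ℕ} (hU : U ⊆ T) (hD : ∀ v ∈ T, G.degIn v C ≤ D) :
    G.pairCount T C ≤ G.pairCount U C + (T.card - U.card) * D := by
  have h1 := pairCount_le (G := G) (S := T \ U) (T := C) (d := D)
    fun v hv => hD v (Finset.mem_sdiff.1 hv).1
  rw [Finset.card_sdiff_of_subset hU] at h1
  have h2 := pairCount_union_left (G := G) (Finset.disjoint_sdiff (s := U) (t := T)) C
  rw [Finset.union_sdiff_of_subset hU] at h2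
  omega

theorem pairCount_self_add_two_le {T : Finset V} {x y : V} (hx : x ∈ T) (hy : y ∈ T) (hxy : x ≠ y)
    (h : ¬ G.Adj x y) : G.pairCount T T + 2 ≤ T.card * (T.card - 1) := by
  have key : ∀ u ∈ T, ∀ v ∈ T, u ≠ v → ¬ G.Adj u v → G.degIn u T + 2 ≤ T.card := by
    intro u hu v hv huv h
    have h1 : T.filter (G.Adj u) ⊆ T \ {u, v} := by
      intro w hw
      rw [Finset.mem_filter] at hw
      simp only [Finset.mem_sdiff, Finset.mem_insert, Finset.mem_singleton, not_or]
      exact ⟨hw.1, hw.2.ne', fun h' => h (h' ▸ hw.2)⟩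
    have h2 := Finset.card_le_card h1
    rw [Finset.card_sdiff_of_subset (by simp [Finset.insert_subset_iff, hu, hv]),
      Finset.card_pair huv] at h2
    have : 2 ≤ T.card := by
      rw [← Finset.card_pair huv]
      exact Finset.card_le_card (by simp [Finset.insert_subset_iff, hu, hv])
    rw [degIn]
    omega
  have h1 := key x hx y hy hxy h
  have h2 := key y hy x hx hxy.symm fun h' => h h'.symm
  have hy' : y ∈ T.erase x := by simp [hy, hxy.symm]
  have h3 := Finset.add_sum_erase T (fun v => G.degIn v T) hx
  have h4 := Finset.add_sum_erase (T.erase x) (fun v => G.degIn v T) hy'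
  have h5 := pairCount_le (G := G) (S := (T.erase x).erase y) (T := T) (d := T.card - 1)
    fun v hv => Nat.le_sub_one_of_lt
      (degIn_self_lt (Finset.mem_of_mem_erase (Finset.mem_of_mem_erase hv)))
  rw [Finset.card_erase_of_mem hy', Finset.card_erase_of_mem hx] at h5
  rw [pairCount] at h5 ⊢
  obtain ⟨t, ht⟩ : ∃ t, T.card = t + 2 := ⟨T.card - 2, by omega⟩
  rw [ht] at h1 h2 h5 ⊢
  simp only [show t + 2 - 1 = t + 1 by omega, show t + 1 - 1 = t by omega] at h5 ⊢
  nlinarith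

/-- Counting the edges of a bipartite graph missing all edges between `P` and `Q`. -/
theorem pairCount_add_mul_le {X Y P Q : Finset V} (hP : P ⊆ X) (hQ : Q ⊆ Y)
    (h : ∀ u ∈ P, ∀ v ∈ Q, ¬ G.Adj u v) :
    G.pairCount X Y + P.card * Q.card ≤ X.card * Y.card := by
  have h1 := pairCount_union_left (G := G) (Finset.disjoint_sdiff (s := P) (t := X)) Y
  have h2 := pairCount_union_right (G := G) P (Finset.disjoint_sdiff (s := Q) (t := Y))
  rw [Finset.union_sdiff_of_subset hP] at h1
  rw [Finset.union_sdiff_of_subset hQ] at h2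
  have h3 : G.pairCount P Q = 0 :=
    Finset.sum_eq_zero fun u hu => degIn_eq_zero fun v hv => h u hu v hv
  have h4 := pairCount_le_mul (G := G) P (Y \ Q)
  have h5 := pairCount_le_mul (G := G) (X \ P) Y
  have h6 := Finset.card_sdiff_add_card_eq_card hP
  have h7 := Finset.card_sdiff_add_card_eq_card hQ
  nlinarith

variable [Fintype V]

theorem pairCount_univ_of_bipartite {C : Finset V} {χ : V → Bool}
    (h : ∀ u ∈ C, ∀ v ∈ C, G.Adj u v → χ u ≠ χ v) (c : Bool) :
    G.pairCount .univ .univ = 2 * G.pairCount (C.filter (χ · = c)) (C.filter (¬ χ · = c)) +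
      2 * G.pairCount Cᶜ C + G.pairCount Cᶜ Cᶜ := by
  have h1 : G.pairCount (C.filter (χ · = c)) (C.filter (χ · = c)) = 0 :=
    Finset.sum_eq_zero fun u hu => degIn_eq_zero fun v hv huv => by
      rw [Finset.mem_filter] at hu hv
      exact h u hu.1 v hv.1 huv (hu.2.trans hv.2.symm)
  have h2 : G.pairCount (C.filter (¬ χ · = c)) (C.filter (¬ χ · = c)) = 0 :=
    Finset.sum_eq_zero fun u hu => degIn_eq_zero fun v hv huv => by
      rw [Finset.mem_filter] at hu hv
      exact h u hu.1 v hv.1 huv ((Bool.eq_not_of_ne hu.2).trans (Bool.eq_not_of_ne hv.2).symm)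
  have h3 := pairCount_self_union (G := G) (Finset.disjoint_filter_filter_not C C (χ · = c))
  rw [Finset.filter_union_filter_not_eq] at h3
  rw [← Finset.union_compl C, pairCount_self_union disjoint_compl_right, h3, h1, h2,
    pairCount_comm C]
  ring

set_option maxHeartbeats 1000000 in
/-- If `G` has many edges then the colouring of a rich part extends along all of its ears. -/
theorem CycleFree.earConsistent {k : ℕ} (hk : 2 ≤ k) (hn : 100 * k ≤ Fintype.card V)
    (hf : G.CycleFree (2 * k + 1)) {C : Finset V} {χ : V → Bool} (hC : IsRich G C χ (2 * k))
    (hT : 1000 * Cᶜ.card ≤ 52 * Fintype.card V)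
    (hd : ∀ v ∈ Cᶜ, 100 * G.degIn v C ≤ 34 * Fintype.card V)
    (he : (Fintype.card V - 2 * k + 1) ^ 2 / 4 + (2 * k).choose 2 ≤ G.edgeSet.ncard) :
    EarConsistent G (C : Set V) χ := by
  by_contra hcon
  obtain ⟨a, M, b, h⟩ := exists_isMinWrongEar hcon
  have hm := hC.le_length_of_wrong (by omega) hf h.isEar h.wrong
  have hcard : C.card + Cᶜ.card = Fintype.card V := Finset.card_add_card_compl C
  obtain ⟨D, hDdef⟩ : ∃ D, D = 34 * Fintype.card V / 100 := ⟨_, rfl⟩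
  have hD : ∀ v ∈ Cᶜ, G.degIn v C ≤ D := fun v hv => by have := hd v hv; omega
  have hMT : M.toFinset ⊆ Cᶜ := fun v hv => by
    simpa using h.isEar.outside v (by simpa using hv)
  have hMcard := List.toFinset_card_of_nodup h.isEar.nodup
  have hmt := Finset.card_le_card hMT
  have hadj : ∀ u ∈ C, ∀ v ∈ C, G.Adj u v → χ u ≠ χ v := fun u hu v hv => hC.adj_ne hk hf hu hv
  have htot := pairCount_univ_of_bipartite hadj (χ a)
  rw [pairCount_univ] at htot
  have hTT := pairCount_self_le (G := G) Cᶜ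
  have hTM := pairCount_le_add hMT hD
  obtain ⟨X, hX⟩ : ∃ X, X = C.filter (χ · = χ a) := ⟨_, rfl⟩
  obtain ⟨Y, hY⟩ : ∃ Y, Y = C.filter (¬ χ · = χ a) := ⟨_, rfl⟩
  rw [← hX, ← hY] at htot
  have hXYc : X.card + Y.card = C.card := by
    rw [hX, hY, Finset.card_filter_add_card_filter_not]
  obtain ⟨x, S, y, rfl⟩ : ∃ x S y, M = x :: (S ++ [y]) := by
    rcases M with _ | ⟨x, M⟩
    · simp at hm; omega
    · rcases List.eq_nil_or_concat M with rfl | ⟨S, y, rfl⟩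
      · simp at hm; omega
      · exact ⟨x, S, y, by simp⟩
  have hnd := h.isEar.nodup
  have hout := h.isEar.outside
  simp only [List.length_cons, List.length_append, List.length_nil, zero_add] at hm hMcard
  have hS1 : ∀ s ∈ S.toFinset, G.degIn s C ≤ 1 := by
    intro s hs
    obtain ⟨S₁, S₂, rfl⟩ := List.append_of_mem (List.mem_toFinset.1 hs)
    have h1 : x :: (S₁ ++ s :: S₂ ++ [y]) = (x :: S₁) ++ s :: (S₂ ++ [y]) := by simp
    rw [h1] at h
    exact h.degIn_le_one (by simp) (by simp)
  have hxC : x ∉ C := fun hx => hout x (by simp) hx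
  have hyC : y ∉ C := fun hy => hout y (by simp) hy
  have hSC := pairCount_le hS1
  have hSnd : S.Nodup := hnd.sublist (by simp)
  rw [List.toFinset_card_of_nodup hSnd, mul_one] at hSC
  have hMsum : G.pairCount (x :: (S ++ [y])).toFinset C =
      G.degIn x C + G.degIn y C + G.pairCount S.toFinset C := by
    have h1 : (x :: (S ++ [y])).toFinset = {x} ∪ ({y} ∪ S.toFinset) := by
      ext; simp; tauto
    simp only [List.nodup_cons, List.mem_append, List.mem_singleton, not_or,
      List.nodup_append] at hnd
    rw [h1, pairCount_union_left (by simp; grind), pairCount_union_left (by simp; grind),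
      pairCount_singleton_left, pairCount_singleton_left, add_assoc]
  have hchain := h.isEar.chain
  have hxa : G.Adj x a := by
    rw [List.cons_append, List.isChain_cons_cons] at hchain
    exact hchain.1.symm
  have hyb : G.Adj y b := by
    rw [List.cons_append, List.append_assoc, ← List.cons_append, ← List.cons_append,
      List.singleton_append, List.isChain_split] at hchain
    simpa using hchain.2
  have ha : a ∈ C := h.isEar.left
  have hb : b ∈ C := h.isEar.right
  have hxcol : ∀ u ∈ C, G.Adj x u → χ u = χ a := fun u hu hxu =>
    hC.eq_of_adj hk hf hu ha hxC hxu hxa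
  have hycol : ∀ u ∈ C, G.Adj y u → χ u = χ b := fun u hu hyu =>
    hC.eq_of_adj hk hf hu hb hyC hyu hyb
  have hXYle := pairCount_le_mul (G := G) X Y
  obtain ⟨t, ht⟩ : ∃ t, t = Cᶜ.card := ⟨_, rfl⟩
  rw [← ht] at hcard hT hTT hTM hmt
  have hxX : C.filter (G.Adj x) ⊆ X := by
    intro u hu
    rw [Finset.mem_filter] at hu
    simpa [hX, hu.1] using hxcol u hu.1 hu.2
  have hα : 1 ≤ G.degIn x C := Finset.card_pos.2 ⟨a, by simp [ha, hxa]⟩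
  have hβ : 1 ≤ G.degIn y C := Finset.card_pos.2 ⟨b, by simp [hb, hyb]⟩
  rw [hMcard, hMsum] at hTM
  rw [hMcard] at hmt
  have hDx := hD x (by simpa using hxC)
  have hDy := hD y (by simpa using hyC)
  have hfin : ∀ q j, 4 * q ≤ (Fintype.card V + 1 - 2 * k - j) ^ 2 → j ≤ t →
      (2 * G.edgeSet.ncard ≤ 2 * q + 2 * (j * D) + (2 * k + j) * (2 * k + j - 1)) →
      (j = 0 → 2 * G.edgeSet.ncard < 2 * q + 2 * k * (2 * k - 1)) → False :=
    fun q j hq hj h1 h2 => ear_count_contradiction hk hn (j := j) (D := D) (q := q) (by omega)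
      (by omega) hq h1 h2 he
  have hq0 : 4 * (X.card * Y.card) ≤ (Fintype.card V - t) ^ 2 := by
    rw [show Fintype.card V - t = X.card + Y.card by omega, ← mul_assoc]
    exact four_mul_le_sq_add _ _
  have harith : ∀ j, t + 1 = 2 * k + j →
      t * (t - 1) + 2 * (2 * k - 1 + j) = (2 * k + j) * (2 * k + j - 1) := by
    intro j hj
    obtain rfl : t = 2 * k - 1 + j := by omega
    obtain ⟨l, hl⟩ : ∃ l, 2 * k = l + 2 := ⟨2 * k - 2, by omega⟩
    rw [hl, show l + 2 - 1 + j = l + j + 1 by omega, show l + 2 + j = l + j + 2 by omega]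
    simp only [Nat.add_sub_cancel, show l + j + 2 - 1 = l + j + 1 by omega]
    ring
  have hDpos : 1 ≤ D := hα.trans hDx
  -- Few edges between the complement and `C` leave no room for further vertices.
  have hgeneric : G.pairCount Cᶜ C ≤ 2 * k - 1 + (t + 1 - 2 * k) * D → 2 * k ≤ t → False := by
    intro h1 h2
    refine hfin (X.card * Y.card) (t + 1 - 2 * k) ?_ (by omega) ?_ (by omega)
    · rw [show Fintype.card V + 1 - 2 * k - (t + 1 - 2 * k) = Fintype.card V - t by omega]
      exact hq0
    · rw [← harith (t + 1 - 2 * k) (by omega)]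
      omega
  rcases Nat.lt_or_ge (2 * k) (S.length + 1 + 1) with hlen | hlen
  · have h1 := pairCount_le_add (U := S.toFinset) (T := Cᶜ) (fun s hs => hMT (by simp_all)) hD
    rw [List.toFinset_card_of_nodup hSnd, ← ht] at h1
    refine hgeneric ?_ (by omega)
    obtain ⟨i, hi⟩ : ∃ i, S.length = 2 * k - 1 + i := ⟨S.length - (2 * k - 1), by omega⟩
    have h2 : t + 1 - 2 * k = (t - S.length) + i := by omega
    rw [h2, add_mul]
    have := Nat.le_mul_of_pos_right i hDpos
    omega
  rcases Nat.lt_or_ge (S.length + 1 + 1) (2 * k) with hlen' | hlen'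
  · have hSl : S.length + 3 = 2 * k := by omega
    have hab : χ a ≠ χ b := by
      rw [Ne, h.wrong, Nat.not_even_iff_odd, Nat.odd_iff]
      simp
      omega
    have hyY : C.filter (G.Adj y) ⊆ Y := by
      intro u hu
      rw [Finset.mem_filter] at hu
      simp only [hY, Finset.mem_filter, hu.1, true_and]
      rw [hycol u hu.1 hu.2]
      exact hab.symm
    have hno : ∀ u ∈ C.filter (G.Adj x), ∀ v ∈ C.filter (G.Adj y), ¬ G.Adj u v := by
      intro u hu v hv huv
      rw [Finset.mem_filter] at hu hv
      have h1 := h.replace hu.1 hv.1 huv.ne hu.2 hv.2 (hxcol u hu.1 hu.2) (hycol v hv.1 hv.2)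
      refine hf.false_of_closed_chain (a := u) (L := x :: (S ++ [y]) ++ [v]) (by omega) ?_ ?_
        (by simp; omega)
      · rw [List.append_assoc, List.singleton_append, List.isChain_cons_split]
        exact ⟨h1.isEar.chain, by simpa using huv.symm⟩
      · have hu' := fun h' => hout u h' hu.1
        have hv' := fun h' => hout v h' hv.1
        rw [List.nodup_cons, List.nodup_append]
        refine ⟨?_, hnd, by simp, ?_⟩
        · rw [List.mem_append, not_or]
          exact ⟨hu', by simpa using huv.ne⟩
        · intro p hp q hq hpq
          rw [List.mem_singleton] at hq
          subst hq hpq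
          exact hv' hp
    have h1 := pairCount_add_mul_le hxX hyY hno
    change _ + G.degIn x C * G.degIn y C ≤ _ at h1
    have h2 := Nat.add_le_one_add_mul hα hβ
    have h3 := harith (t + 1 - 2 * k) (by omega)
    refine hfin (X.card * Y.card) (t + 1 - 2 * k) ?_ (by omega) ?_ ?_
    · rw [show Fintype.card V + 1 - 2 * k - (t + 1 - 2 * k) = Fintype.card V - t by omega]
      exact hq0
    · rw [← h3]
      rw [show t - (S.length + 1 + 1) = t + 1 - 2 * k by omega] at hTM
      omega
    · intro h0
      rw [show t - (S.length + 1 + 1) = 0 by omega] at hTM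
      rw [h0] at h3
      simp only [add_zero] at h3
      omega
  · have hSl : S.length + 2 = 2 * k := by omega
    have hab : χ b = χ a := by
      rw [eq_comm, h.wrong, Nat.even_iff]
      simp
      omega
    rw [show t - (S.length + 1 + 1) = t - 2 * k by omega] at hTM
    have hsplit : (t + 1 - 2 * k) * D = (t - 2 * k) * D + D := by
      rw [← Nat.succ_mul, Nat.succ_eq_add_one]
      congr 1
      omega
    rcases Nat.lt_or_ge (G.degIn x C) 2 with hα2 | hα2
    · exact hgeneric (by omega) (by omega)
    rcases Nat.lt_or_ge (G.degIn y C) 2 with hβ2 | hβ2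
    · exact hgeneric (by omega) (by omega)
    have hyX : C.filter (G.Adj y) ⊆ X := by
      intro u hu
      rw [Finset.mem_filter] at hu
      simp only [hX, Finset.mem_filter, hu.1, true_and]
      rw [hycol u hu.1 hu.2, hab]
    have hdisj : Disjoint (C.filter (G.Adj x)) (C.filter (G.Adj y)) := by
      rw [Finset.disjoint_left]
      intro u hu hu'
      rw [Finset.mem_filter] at hu hu'
      refine hf.false_of_closed_chain (a := u) (L := x :: (S ++ [y])) (by omega) ?_ ?_
        (by simp; omega)
      · rw [List.cons_append, List.append_assoc, ← List.cons_append, List.singleton_append] at hchain ⊢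
        rw [List.cons_append, List.isChain_cons_cons] at hchain ⊢
        refine ⟨hu.2.symm, ?_⟩
        rw [← List.cons_append, List.isChain_split] at hchain ⊢
        exact ⟨hchain.2.1, by simpa using hu'.2⟩
      · rw [List.nodup_cons]
        exact ⟨fun h' => hout u h' hu.1, hnd⟩
    have hαβ : G.degIn x C + G.degIn y C ≤ X.card := by
      rw [degIn, degIn, ← Finset.card_union_of_disjoint hdisj]
      exact Finset.card_le_card (Finset.union_subset hxX hyX)
    have hS0 : G.pairCount S.toFinset C = 0 := by
      refine Finset.sum_eq_zero fun s hs => degIn_eq_zero fun z hz hsz => ?_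
      obtain ⟨u, hu, huz, hxu⟩ := exists_adj_of_card_lt_degIn (F := {z}) (v := x) (T := C) (G := G)
        (by simp; omega)
      obtain ⟨v, hv, hvz, hyv⟩ := exists_adj_of_card_lt_degIn (F := {z}) (v := y) (T := C) (G := G)
        (by simp; omega)
      have huv : u ≠ v := by
        rintro rfl
        exact Finset.disjoint_left.1 hdisj (Finset.mem_filter.2 ⟨hu, hxu⟩)
          (Finset.mem_filter.2 ⟨hu, hyv⟩)
      have h1 := h.replace hu hv huv hxu hyv (hxcol u hu hxu) (hycol v hv hyv)
      obtain ⟨S₁, S₂, rfl⟩ := List.append_of_mem (List.mem_toFinset.1 hs)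
      have h2 : x :: (S₁ ++ s :: S₂ ++ [y]) = (x :: S₁) ++ s :: (S₂ ++ [y]) := by simp
      rw [h2] at h1
      rcases h1.eq_or_eq_of_adj (by simp) (by simp) hz hsz with rfl | rfl
      · simp at huz
      · simp at hvz
    have hTT' : G.pairCount Cᶜ Cᶜ + 2 ≤ t * (t - 1) := by
      obtain ⟨x₂, x₃, x₄, L, hL⟩ : ∃ x₂ x₃ x₄ L, S ++ [y] = x₂ :: x₃ :: x₄ :: L := by
        rcases S with _ | ⟨x₂, _ | ⟨x₃, S⟩⟩
        · simp at hSl; omega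
        · simp at hSl; omega
        · rcases S with _ | ⟨x₄, S⟩
          · exact ⟨x₂, x₃, y, [], rfl⟩
          · exact ⟨x₂, x₃, x₄, S ++ [y], rfl⟩
      rw [hL] at h hout hnd
      rw [ht]
      refine pairCount_self_add_two_le (x := x) (y := x₄) (by simpa using hxC) ?_ ?_
        h.not_adj_of_length_four
      · simpa using hout x₄ (by simp)
      · simp only [List.nodup_cons, List.mem_cons] at hnd
        tauto
    refine hfin (X.card * Y.card + X.card) (t - 2 * k) ?_ (by omega) ?_ ?_
    · rw [show Fintype.card V + 1 - 2 * k - (t - 2 * k) = X.card + Y.card + 1 by omega]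
      exact Nat.four_mul_mul_add_le X.card Y.card
    · rw [show 2 * k + (t - 2 * k) = t by omega]
      omega
    · intro h0
      obtain rfl : t = 2 * k := by omega
      simp only [Nat.sub_self, zero_mul, add_zero] at hTM
      omega

end SimpleGraph

end WrongEarCounting

section Attachments

variable {V : Type*} {G : SimpleGraph V}

/-- If `D` has no nonempty ears then every component outside `D` attaches to a single vertex. -/
theorem exists_attachment {D : Set V} (hD : ∀ ⦃a M b⦄, IsEar G D a M b → M = []) {d₀ : V}
    (hd₀ : d₀ ∈ D) :
    ∃ f : V → V, (∀ x, f x ∈ D) ∧ (∀ x ∉ D, ∀ y ∉ D, G.Adj x y → f x = f y) ∧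
      ∀ x ∉ D, ∀ y ∈ D, G.Adj x y → y = f x := by
  classical
  let H : SimpleGraph V :=
    { Adj := fun x y => G.Adj x y ∧ x ∉ D ∧ y ∉ D
      symm := ⟨fun x y h => ⟨h.1.symm, h.2.2, h.2.1⟩⟩
      loopless := ⟨fun x h => G.irrefl h.1⟩ }
  have hsupp : ∀ {x y : V} (p : H.Walk x y), x ∉ D → ∀ z ∈ p.support, z ∉ D := by
    intro x y p
    induction p with
    | nil => intro hx z hz; simp_all
    | cons hadj p ih =>
      intro hx z hz
      rw [SimpleGraph.Walk.support_cons, List.mem_cons] at hz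
      rcases hz with rfl | hz
      · exact hx
      · exact ih hadj.2.2 z hz
  have huniq : ∀ {x y d d' : V}, x ∉ D → d ∈ D → d' ∈ D → H.Reachable x y → G.Adj x d →
      G.Adj y d' → d = d' := by
    intro x y d d' hx hd hd' hxy hxd hyd
    by_contra hne
    obtain ⟨p, hp⟩ := hxy.exists_isPath
    refine p.support_ne_nil (hD (a := d) (b := d') ⟨hd, hd', hne, hsupp p hx, hp.support_nodup, ?_⟩)
    have hc := p.isChain_adj_support.imp fun u v huv => (show H.Adj u v from huv).1
    rw [List.isChain_cons, List.isChain_append]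
    refine ⟨fun u hu => ?_, hc, by simp, fun u hu v hv => ?_⟩
    · have h1 : u = x := by
        have h2 := p.head_support
        rw [List.head_eq_iff_head?_eq_some] at h2
        rw [List.head?_append, h2] at hu
        simpa using hu.symm
      exact h1 ▸ hxd.symm
    · have h1 : u = y := by
        have h2 := p.getLast_support
        rw [List.getLast_eq_iff_getLast?_eq_some] at h2
        rw [h2] at hu
        simpa using hu.symm
      simp only [List.head?_cons, Option.mem_def, Option.some.injEq] at hv
      subst h1 hv
      exact hyd
  let S : V → Set V := fun x => {d | d ∈ D ∧ ∃ y, H.Reachable x y ∧ G.Adj y d}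
  let g : Set V → V := fun s => if h : s.Nonempty then h.some else d₀
  have hg : ∀ x (h : (S x).Nonempty), g (S x) ∈ S x := fun x h => by
    simp only [g, dif_pos h]
    exact h.some_mem
  refine ⟨fun x => g (S x), fun x => ?_, fun x hx y hy hxy => ?_, fun x hx y hy hxy => ?_⟩
  · by_cases h : (S x).Nonempty
    · exact (hg x h).1
    · simpa only [g, dif_neg h] using hd₀
  · have h1 : H.Reachable x y := SimpleGraph.Adj.reachable (show H.Adj x y from ⟨hxy, hx, hy⟩)
    have h2 : S x = S y := by
      ext d
      exact and_congr_right fun _ => exists_congr fun z => and_congr_left fun _ =>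
        ⟨fun h => h1.symm.trans h, fun h => h1.trans h⟩
    simp only [h2]
  · obtain ⟨hd, z, hz, hzd⟩ := hg x ⟨y, hy, x, .rfl, hxy⟩
    exact huniq hx hy hd hz hxy hzd

end Attachments

section Dichotomy

theorem familyG_of_attachment {n r : ℕ} {G : SimpleGraph (Fin n)} {D : Finset (Fin n)}
    {χ : Fin n → Bool} (hχ : ∀ x ∈ D, ∀ y ∈ D, G.Adj x y → χ x ≠ χ y) {f : Fin n → Fin n}
    (hf : ∀ x, f x ∈ D) (hf₁ : ∀ x ∉ D, ∀ y ∉ D, G.Adj x y → f x = f y)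
    (hf₂ : ∀ x ∉ D, ∀ y ∈ D, G.Adj x y → y = f x) (hD : Dᶜ.card ≤ r - 2) : FamilyG n r G := by
  have hU : Finset.univ.biUnion (fun i => Dᶜ.filter (f · = i)) = Dᶜ := by
    ext x; simp
  refine ⟨n, fun i => Dᶜ.filter (f · = i), fun i => if i ∈ D then i else f i, ?_⟩
  rw [hU]
  refine ⟨fun i j hij => ?_, hD, fun i => ?_, ⟨{x | χ x = true}, fun x y hxy hx hy => ?_⟩,
    fun i j hij x hx y hy hxy => ?_, fun i x hx y hxy hy => ?_⟩
  · rw [Finset.disjoint_left]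
    intro x hx hx'
    rw [Finset.mem_filter] at hx hx'
    exact hij (hx.2.symm.trans hx'.2)
  · rw [Finset.notMem_compl]
    dsimp only
    split_ifs with h
    exacts [h, hf i]
  · rw [Finset.notMem_compl] at hx hy
    have := hχ x hx y hy hxy
    simp only [Set.mem_ofPred_eq]
    cases h1 : χ x <;> cases h2 : χ y <;> simp_all
  · rw [Finset.mem_filter, Finset.mem_compl] at hx hy
    exact hij (hx.2.symm.trans ((hf₁ x hx.1 y hy.1 hxy).trans hy.2))
  · rw [Finset.mem_filter, Finset.mem_compl] at hx
    rw [Finset.notMem_compl] at hy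
    obtain rfl := hx.2
    simp only [if_pos (hf x)]
    exact hf₂ x hx.1 y hy hxy

theorem Fin.card_filter_le_val_lt {n a b : ℕ} (hb : b ≤ n) :
    (Finset.univ.filter fun i : Fin n => a ≤ i ∧ (i : ℕ) < b).card = b - a := by
  rw [← Finset.card_map Fin.valEmbedding, ← Nat.card_Ico]
  congr 1
  ext m
  simp only [Finset.mem_map, Finset.mem_filter, Finset.mem_univ, true_and, Fin.valEmbedding_apply,
    Finset.mem_Ico]
  exact ⟨by rintro ⟨i, hi, rfl⟩; exact hi, fun hm => ⟨⟨m, by omega⟩, hm, rfl⟩⟩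

theorem exists_equiv_of_card {n N : ℕ} (hN : N ≤ n) {D P : Finset (Fin n)} (hPD : P ⊆ D)
    (hP : P.card = N / 2) (hD : D.card = N) :
    ∃ e : Fin n ≃ Fin n, (∀ x, (e x : ℕ) < N / 2 ↔ x ∈ P) ∧ ∀ x, (e x : ℕ) < N ↔ x ∈ D := by
  let f : Fin n → Fin 3 := fun x => if x ∈ P then 0 else if x ∈ D then 1 else 2
  let g : Fin n → Fin 3 := fun i => if (i : ℕ) < N / 2 then 0 else if (i : ℕ) < N then 1 else 2
  have hf0 : ∀ x, f x = 0 ↔ x ∈ P := fun x => by simp only [f]; split_ifs <;> simp_all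
  have hf1 : ∀ x, f x = 1 ↔ x ∈ D \ P := fun x => by simp only [f]; split_ifs <;> simp_all
  have hf2 : ∀ x, f x = 2 ↔ x ∈ Dᶜ := fun x => by
    have := @hPD x
    simp only [f]
    split_ifs <;> simp_all
  have hg0 : ∀ i, g i = 0 ↔ 0 ≤ (i : ℕ) ∧ (i : ℕ) < N / 2 := fun i => by
    simp only [g]; split_ifs <;> simp_all
  have hg1 : ∀ i, g i = 1 ↔ N / 2 ≤ (i : ℕ) ∧ (i : ℕ) < N := fun i => by
    simp only [g]; split_ifs <;> simp <;> omega
  have hg2 : ∀ i, g i = 2 ↔ N ≤ (i : ℕ) ∧ (i : ℕ) < n := fun i => by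
    simp only [g]; split_ifs <;> simp <;> omega
  have hcard : ∀ c, Fintype.card {x // f x = c} = Fintype.card {i // g i = c} := by
    intro c
    rw [Fintype.card_subtype, Fintype.card_subtype]
    fin_cases c
    · simp only [Fin.zero_eta, hf0, hg0, Fin.card_filter_le_val_lt
        (show N / 2 ≤ n by omega), Finset.filter_univ_mem, hP, Nat.sub_zero]
    · simp only [Fin.mk_one, hf1, hg1, Fin.card_filter_le_val_lt hN,
        Finset.filter_univ_mem, Finset.card_sdiff_of_subset hPD, hP, hD]
    · simp only [Fin.reduceFinMk, hf2, hg2, Fin.card_filter_le_val_lt le_rfl,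
        Finset.filter_univ_mem, Finset.card_compl, Fintype.card_fin, hD]
  let e := Equiv.ofFiberEquiv (f := f) (g := g) fun c => Fintype.equivOfCardEq (hcard c)
  have he : ∀ x, g (e x) = f x := Equiv.ofFiberEquiv_map _
  refine ⟨e, fun x => ?_, fun x => ?_⟩
  · rw [← hf0, ← he, hg0]
    simp
  · have h1 := hf2 x
    rw [← he, hg2, Finset.mem_compl] at h1
    have := (e x).2
    constructor
    · intro h
      by_contra h'
      have := h1.2 h'
      omega
    · intro h
      by_contra h'
      exact h1.1 ⟨by omega, by omega⟩ h

theorem exists_iso_turanSuspAt {n N : ℕ} (hN : N ≤ n) {G : SimpleGraph (Fin n)}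
    {D : Finset (Fin n)} {χ : Fin n → Bool} {c : Bool} {v : Fin n} (hv : v ∈ D)
    (hP : (D.filter (χ · = c)).card = N / 2) (hD : D.card = N)
    (hχ : ∀ x ∈ D, ∀ y ∈ D, (G.Adj x y ↔ χ x ≠ χ y))
    (hT : ∀ x ∉ D, ∀ y ∉ D, x ≠ y → G.Adj x y) (hTD : ∀ x ∉ D, ∀ y ∈ D, (G.Adj x y ↔ y = v)) :
    ∃ v₀ < N, Nonempty (G ≃g turanSuspAt n N v₀) := by
  obtain ⟨e, h1, h2⟩ := exists_equiv_of_card hN (Finset.filter_subset _ _) hP hD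
  refine ⟨e v, (h2 v).2 hv, ⟨e, ?_⟩⟩
  have hev : ∀ x, (e x : ℕ) = e v ↔ x = v := fun x => by rw [Fin.val_inj, e.apply_eq_iff_eq]
  have h3 : ∀ y, N / 2 ≤ (e y : ℕ) ∧ (e y : ℕ) < N ↔ y ∈ D ∧ χ y ≠ c := fun y => by
    rw [← not_lt, h1, h2, Finset.mem_filter]
    tauto
  have h4 : ∀ y, N ≤ (e y : ℕ) ↔ y ∉ D := fun y => by rw [← not_lt, h2]
  have key : ∀ x y, (turanSuspAt n N (e v)).Adj (e x) (e y) ↔ x ≠ y ∧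
      ((x ∈ D ∧ χ x = c ∧ y ∈ D ∧ χ y ≠ c ∨ (x = v ∨ x ∉ D) ∧ (y = v ∨ y ∉ D)) ∨
        (y ∈ D ∧ χ y = c ∧ x ∈ D ∧ χ x ≠ c ∨ (y = v ∨ y ∉ D) ∧ (x = v ∨ x ∉ D))) := by
    intro x y
    simp only [turanSuspAt, SimpleGraph.fromRel_adj, e.injective.ne_iff, hev, h1, h3, h4,
      Finset.mem_filter, and_assoc]
  intro x y
  rw [key]
  by_cases hx : x ∈ D <;> by_cases hy : y ∈ D
  · rw [hχ x hx y hy]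
    simp only [hx, hy, true_and, not_true, or_false]
    constructor
    · rintro ⟨h, h' | h'⟩ <;> rcases h' with h' | h'
      · exact fun h3 => h'.2 (h3 ▸ h'.1)
      · exact absurd (h'.1.trans h'.2.symm) h
      · exact fun h3 => h'.2 (h3 ▸ h'.1)
      · exact absurd (h'.2.trans h'.1.symm) h
    · intro h
      refine ⟨fun h' => h (by rw [h']), ?_⟩
      cases h3 : χ x <;> cases h4 : χ y <;> cases c <;> simp_all
  · rw [G.adj_comm, hTD y hy x hx]
    simp only [hx, hy, not_false_eq_true, not_true, true_and, false_and, and_false, or_true,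
      or_false, false_or, and_true, or_self]
    exact ⟨fun h => h.2, fun h => ⟨fun h' => hy (h' ▸ hx), h⟩⟩
  · rw [hTD x hx y hy]
    simp only [hx, hy, not_false_eq_true, not_true, true_and, false_and, and_false, or_true,
      or_false, false_or, and_true, or_self]
    exact ⟨fun h => h.2, fun h => ⟨fun h' => hx (h' ▸ hy), h⟩⟩
  · simp only [hx, hy, not_false_eq_true, or_true, and_true]
    exact ⟨hT x hx y hy, fun h => h.ne⟩

end Dichotomy

section Main

/-- Numerical equality case for the edge count. -/
theorem edge_count_equality {n r p q w e E₁ E₂ E₃ : ℕ} (hr3 : 3 ≤ r) (hr : 50 * r ≤ n)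
    (hn : p + q + w = n) (hw : 1000 * w ≤ 52 * n) (hrw : r ≤ w + 1) (h₁ : E₁ ≤ p * q) (h₂ : E₂ ≤ w)
    (h₃ : E₃ ≤ w * (w - 1)) (hE : 2 * e = 2 * E₁ + 2 * E₂ + E₃)
    (he : (n - r + 1) ^ 2 / 4 + r.choose 2 ≤ e) :
    w + 1 = r ∧ E₁ = p * q ∧ E₂ = w ∧ E₃ = w * (w - 1) ∧ p * q = (n - r + 1) ^ 2 / 4 := by
  have hch : 2 * r.choose 2 = r * (r - 1) := by
    rw [Nat.choose_two_right, Nat.mul_div_cancel' (Nat.even_mul_pred_self r).two_dvd]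
  obtain ⟨w, rfl⟩ : ∃ w', w = w' + 1 := ⟨w - 1, by omega⟩
  obtain ⟨s, rfl⟩ : ∃ s, r = s + 1 := ⟨r - 1, by omega⟩
  obtain ⟨j, hj⟩ : ∃ j, w + 1 = s + j := ⟨w + 1 - s, by omega⟩
  have hpq := four_mul_le_sq_add p q
  rw [mul_assoc] at hpq
  have hN : n - (s + 1) + 1 = p + q + j := by omega
  rw [hN] at he ⊢
  simp only [Nat.add_sub_cancel] at h₃ hch ⊢
  have hdiv := Nat.div_add_mod ((p + q + j) ^ 2) 4
  have hmod := Nat.mod_lt ((p + q + j) ^ 2) (show 4 > 0 by norm_num)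
  have hj0 : j = 0 := by
    by_contra hj0
    have hmod' : (p + q + j) ^ 2 % 4 ≤ 1 := by
      rw [Nat.pow_mod]
      have := Nat.mod_lt (p + q + j) (show 4 > 0 by norm_num)
      interval_cases (p + q + j) % 4 <;> simp
    have h4 : (p + q + j) ^ 2 + 2 * ((s + 1) * s) ≤
        (p + q) ^ 2 + 4 * (w + 1) + 2 * ((w + 1) * w) + 1 := by omega
    have hbig : 1 + 3 * j + 4 * s + 3 ≤ 2 * (p + q + j) := by omega
    obtain rfl : w = s + j - 1 := by omega
    obtain ⟨i, rfl⟩ : ∃ i, j = i + 1 := ⟨j - 1, by omega⟩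
    simp only [show s + (i + 1) - 1 = s + i by omega] at h4
    nlinarith [Nat.mul_le_mul_left (i + 1) hbig]
  subst hj0
  obtain rfl : w + 1 = s := by omega
  simp only [add_zero] at *
  have h5 : (w + 1 + 1) * (w + 1) = (w + 1) * w + 2 * (w + 1) := by ring
  refine ⟨trivial, ?_, ?_, ?_, ?_⟩
  all_goals omega

theorem Nat.eq_half_or_of_mul_eq {p q N : ℕ} (h : p + q = N) (hpq : p * q = N ^ 2 / 4) :
    p = N / 2 ∨ q = N / 2 := by
  wlog hle : p ≤ q generalizing p q
  · exact (this (by omega) (by rwa [mul_comm]) (by omega)).symm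
  left
  obtain ⟨d, rfl⟩ := Nat.exists_eq_add_of_le hle
  have h1 := Nat.div_add_mod (N ^ 2) 4
  have h2 := Nat.mod_lt (N ^ 2) (show 4 > 0 by norm_num)
  rw [← hpq, ← h] at h1
  rw [← h] at h2
  have h3 : d ^ 2 < 4 := by nlinarith
  have h4 : d < 2 := by nlinarith
  omega

theorem SimpleGraph.adj_of_pairCount_eq {V : Type*} [DecidableEq V] {G : SimpleGraph V}
    [DecidableRel G.Adj] {S T : Finset V} (h : G.pairCount S T = S.card * T.card) {x y : V}
    (hx : x ∈ S) (hy : y ∈ T) : G.Adj x y := by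
  by_contra hxy
  have := pairCount_add_mul_le (G := G) (X := S) (Y := T) (P := {x}) (Q := {y}) (by simpa) (by simpa)
    (by simpa)
  simp at this
  omega

theorem familyG_or_iso_of_noEars {n r : ℕ} {G : SimpleGraph (Fin n)} [DecidableRel G.Adj]
    (hr3 : 3 ≤ r) (hr : 50 * r ≤ n) (he : (n - r + 1) ^ 2 / 4 + r.choose 2 ≤ G.edgeSet.ncard)
    {D : Finset (Fin n)} {χ : Fin n → Bool} (hχ : ∀ x ∈ D, ∀ y ∈ D, G.Adj x y → χ x ≠ χ y)
    (hD : ∀ ⦃a M b⦄, IsEar G (D : Set (Fin n)) a M b → M = []) (hw : 1000 * Dᶜ.card ≤ 52 * n) :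
    FamilyG n r G ∨
      ∃ v₀ : ℕ, v₀ < n - r + 1 ∧ Nonempty (G ≃g turanSuspAt n (n - r + 1) v₀) := by
  have hcard : D.card + Dᶜ.card = n := by simp [Finset.card_add_card_compl]
  obtain ⟨d₀, hd₀⟩ : D.Nonempty := Finset.card_pos.1 (by omega)
  obtain ⟨f, hf, hf₁, hf₂⟩ := exists_attachment hD (by simpa using hd₀)
  simp only [Finset.mem_coe] at hf hf₁ hf₂
  rcases Nat.lt_or_ge (Dᶜ.card + 1) r with hlt | hge
  · exact .inl (familyG_of_attachment hχ hf hf₁ hf₂ (by omega))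
  right
  have htot := G.pairCount_univ_of_bipartite hχ
  have hcol := fun c => Finset.card_filter_add_card_filter_not (s := D) (χ · = c)
  have hdeg : ∀ x ∈ Dᶜ, G.degIn x D ≤ 1 := fun x hx => by
    rw [SimpleGraph.degIn, Finset.card_le_one]
    intro y hy z hz
    rw [Finset.mem_filter] at hy hz
    rw [Finset.mem_compl] at hx
    rw [hf₂ x hx y hy.1 hy.2, hf₂ x hx z hz.1 hz.2]
  have hWD := SimpleGraph.pairCount_le hdeg
  rw [mul_one] at hWD
  have hWW := SimpleGraph.pairCount_self_le (G := G) Dᶜ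
  rw [SimpleGraph.pairCount_univ] at htot
  have hall := fun c => edge_count_equality hr3 hr (by rw [hcol c]; exact hcard) hw hge
    (SimpleGraph.pairCount_le_mul _ _) hWD hWW (htot c) he
  have hN : n - r + 1 = D.card := by have := (hall true).1; omega
  rw [hN] at hall ⊢
  have hT : ∀ x ∉ D, ∀ y ∉ D, x ≠ y → G.Adj x y := by
    intro x hx y hy hxy
    by_contra hadj
    have h1 := SimpleGraph.pairCount_self_add_two_le (T := Dᶜ) (by simpa) (by simpa) hxy hadj
    have h2 := (hall true).2.2.2.1
    omega
  have hadj : ∀ x ∉ D, G.Adj x (f x) := by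
    intro x hx
    by_contra hadj
    have h0 : G.degIn x D = 0 := SimpleGraph.degIn_eq_zero fun y hy hxy =>
      hadj (hf₂ x hx y hy hxy ▸ hxy)
    have h1 : G.pairCount Dᶜ D < ∑ _y ∈ Dᶜ, 1 :=
      Finset.sum_lt_sum hdeg ⟨x, by simpa using hx, by omega⟩
    have h2 := (hall true).2.2.1
    simp at h1
    omega
  obtain ⟨x₀, hx₀⟩ : Dᶜ.Nonempty := Finset.card_pos.1 (by omega)
  rw [Finset.mem_compl] at hx₀
  have hfc : ∀ x ∉ D, f x = f x₀ := fun x hx => by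
    rcases eq_or_ne x x₀ with rfl | hne
    · rfl
    · exact hf₁ x hx x₀ hx₀ (hT x hx x₀ hx₀ hne)
  obtain ⟨c, hc⟩ : ∃ c, (D.filter (χ · = c)).card = D.card / 2 := by
    have h1 := hcol true
    have h2 : D.filter (¬ χ · = true) = D.filter (χ · = false) := by simp
    have h3 := (hall true).2.2.2.2
    rcases Nat.eq_half_or_of_mul_eq h1 h3 with h | h
    · exact ⟨true, h⟩
    · exact ⟨false, h2 ▸ h⟩
  refine exists_iso_turanSuspAt (by omega) (hf x₀) hc rfl (fun x hx y hy => ⟨hχ x hx y hy, ?_⟩) hT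
    fun x hx y hy => ⟨fun h => (hf₂ x hx y hy h).trans (hfc x hx), ?_⟩
  · intro hxy
    exact SimpleGraph.adj_of_pairCount_eq (hall (χ x)).2.1 (by simp [hx])
      (by simpa [hy] using hxy.symm)
  · rintro rfl
    exact hfc x hx ▸ hadj x hx

end Main

section EdgeThreshold

theorem edge_threshold_anti {k r n : ℕ} (hr3 : 3 ≤ r) (hr : r ≤ 2 * k) (hn : 100 * k ≤ n) :
    (n - 2 * k + 1) ^ 2 / 4 + (2 * k).choose 2 ≤ (n - r + 1) ^ 2 / 4 + r.choose 2 := by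
  generalize hm : 2 * k = m at *
  have hn' : 50 * m ≤ n := by omega
  clear hm hn
  induction m, hr using Nat.le_induction with
  | base => exact le_rfl
  | succ m hm ih =>
    refine le_trans ?_ (ih (by omega))
    obtain ⟨s, hs⟩ : ∃ s, n - m + 1 = s + 1 := ⟨n - m, by omega⟩
    rw [show n - (m + 1) + 1 = s by omega, hs, Nat.choose_succ_succ' m 1, Nat.choose_one_right]
    have h1 : s ^ 2 / 4 + m ≤ (s + 1) ^ 2 / 4 := by
      rw [← Nat.add_mul_div_left _ _ (by norm_num : 0 < 4)]
      refine Nat.div_le_div_right ?_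
      have h2 : 2 * m ≤ s := by omega
      nlinarith
    change s ^ 2 / 4 + (m + m.choose 2) ≤ _
    omega

theorem dense_of_edge_threshold {k n e : ℕ} (hk : 2 ≤ k) (hn : 100 * k ≤ n)
    (he : (n - 2 * k + 1) ^ 2 / 4 + (2 * k).choose 2 ≤ e) : 4802 * n ^ 2 ≤ 10000 * (2 * e) := by
  obtain ⟨s, hs⟩ : ∃ s, n = s + 2 * k := ⟨n - 2 * k, by omega⟩
  rw [show n - 2 * k + 1 = s + 1 by omega] at he
  have h1 : (s + 1) ^ 2 ≤ 4 * e + 3 := by omega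
  have h2 : 49 * n ≤ 50 * s := by omega
  nlinarith

end EdgeThreshold

/-- Theorem: strong edge stability for `C_{2k+1}`-free graphs.
If `k ≥ 2`, `3 ≤ r ≤ 2k`, `n ≥ 100 k`, and `G` is an `n`-vertex `C_{2k+1}`-free graph
with `e(G) ≥ ⌊(n-r+1)²/4⌋ + C(r,2)`, then `G ∈ 𝒢_{n,r}`, unless `G` is obtained from the
bipartite Turán graph `T_{n-r+1,2}` by suspending `K_r`. -/
theorem stmt_0 (k r n : ℕ) (hk : 2 ≤ k) (hr3 : 3 ≤ r) (hr : r ≤ 2 * k)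
    (hn : 100 * k ≤ n) (G : SimpleGraph (Fin n))
    (hfree : G.CycleFree (2 * k + 1))
    (he : (n - r + 1) ^ 2 / 4 + r.choose 2 ≤ G.edgeSet.ncard) :
    FamilyG n r G ∨
      ∃ v0 : ℕ, v0 < n - r + 1 ∧ Nonempty (G ≃g turanSuspAt n (n - r + 1) v0) := by
  classical
  have he' := (edge_threshold_anti hr3 hr hn).trans he
  obtain ⟨C, χ, hC, hT, hd⟩ := hfree.exists_isRich hk (by simpa using hn) (by
    rw [SimpleGraph.pairCount_univ, Fintype.card_fin]
    exact dense_of_edge_threshold hk hn he')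
  have hcons := hfree.earConsistent hk (by simpa using hn) hC hT hd (by simpa using he')
  obtain ⟨D, χ', hCD, hχ', hD⟩ := hcons.exists_maximal
  obtain ⟨D, rfl⟩ : ∃ D' : Finset (Fin n), D = D' := ⟨D.toFinset, by simp⟩
  have hle := Finset.card_le_card (Finset.compl_subset_compl.2 (Finset.coe_subset.1 hCD))
  rw [Fintype.card_fin] at hT
  exact familyG_or_iso_of_noEars hr3 (by omega) he
    (fun x hx y hy => hχ'.adj_ne (Finset.mem_coe.2 hx) (Finset.mem_coe.2 hy)) hD (by omega)
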